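/- arXiv:1311.0599 — 4 statements merged into one kernel-verified Lean document; each statement's English description precedes it below -/
import Mathlib

section
/- For any positive integers n, m, and s, the number of conjugacy classes of the compact symplectic group Sp(n) consisting of elements x with x^m = 1 and with exactly s distinct conjugate pairs of eigenvalues equals C(n-1, s-1) · C(⌊m/2⌋ + 1, s). -/
open Matrix

/-- The compact symplectic group `Sp(n)`, as the subgroup of the unitary group of
`2n × 2n` complex matrices (indexed by `Fin n ⊕ Fin n`) consisting of those matrices whose
underlying matrix lies in the symplectic group (preserves the standard symplectic form `J`). -/
noncomputable def Sp (n : ℕ) : Subgroup (Matrix.unitaryGroup (Fin n ⊕ Fin n) ℂ) where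
  carrier := {x | (x : Matrix (Fin n ⊕ Fin n) (Fin n ⊕ Fin n) ℂ) ∈ Matrix.symplecticGroup (Fin n) ℂ}
  one_mem' := (Matrix.symplecticGroup (Fin n) ℂ).one_mem
  mul_mem' := fun ha hb => (Matrix.symplecticGroup (Fin n) ℂ).mul_mem ha hb
  inv_mem' := by
    intro x hx
    have h1 : ((x⁻¹ : Matrix.unitaryGroup (Fin n ⊕ Fin n) ℂ) : Matrix (Fin n ⊕ Fin n) (Fin n ⊕ Fin n) ℂ)
        = (x : Matrix (Fin n ⊕ Fin n) (Fin n ⊕ Fin n) ℂ)⁻¹ := by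
      rw [Matrix.UnitaryGroup.inv_val]
      exact (Matrix.inv_eq_left_inv (Matrix.UnitaryGroup.star_mul_self x)).symm
    have h2 : ((x : Matrix (Fin n ⊕ Fin n) (Fin n ⊕ Fin n) ℂ))⁻¹ ∈ Matrix.symplecticGroup (Fin n) ℂ := by
      rw [← SymplecticGroup.coe_inv' ⟨_, hx⟩]
      exact ((⟨_, hx⟩ : Matrix.symplecticGroup (Fin n) ℂ)⁻¹).2
    simpa only [Set.mem_setOf_eq, h1] using h2

namespace CompactSymplectic

/-- The quaternionic structure `v ↦ J v̄` on `ℂ²ⁿ`. -/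
noncomputable def quat {n : ℕ} (v : Fin n ⊕ Fin n → ℂ) : Fin n ⊕ Fin n → ℂ :=
  J (Fin n) ℂ *ᵥ star v

section quat

variable {n : ℕ} (u v : Fin n ⊕ Fin n → ℂ)

@[simp]
lemma quat_inl (i : Fin n) : quat v (Sum.inl i) = -star (v (Sum.inr i)) := by
  simp [quat, J, mulVec, dotProduct, fromBlocks, Matrix.one_apply]

@[simp]
lemma quat_inr (i : Fin n) : quat v (Sum.inr i) = star (v (Sum.inl i)) := by
  simp [quat, J, mulVec, dotProduct, fromBlocks, Matrix.one_apply]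

lemma quat_smul (c : ℂ) : quat (c • v) = star c • quat v := by
  ext (i | i) <;> simp

@[simp]
lemma quat_quat : quat (quat v) = -v := by
  ext (i | i) <;> simp

lemma star_quat_dotProduct_quat : star (quat u) ⬝ᵥ quat v = star v ⬝ᵥ u := by
  simp [dotProduct, add_comm, mul_comm]

lemma star_dotProduct_quat_comm : star u ⬝ᵥ quat v = -(star v ⬝ᵥ quat u) := by
  simp [dotProduct, mul_comm]

@[simp]
lemma star_dotProduct_quat_self : star v ⬝ᵥ quat v = 0 :=
  self_eq_neg.mp (star_dotProduct_quat_comm v v)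

lemma star_quat_dotProduct : star (quat u) ⬝ᵥ v = star (star v ⬝ᵥ quat u) := by
  rw [star_dotProduct]

lemma dotProduct_J_mulVec : u ⬝ᵥ J (Fin n) ℂ *ᵥ v = star (star u ⬝ᵥ quat v) := by
  have : J (Fin n) ℂ *ᵥ v = star (quat v) := by
    ext (i | i) <;> simp [J, mulVec, dotProduct, fromBlocks, Matrix.one_apply]
  rw [this, dotProduct_star, dotProduct_comm]

end quat

lemma mulVec_quat {n : ℕ} (x : Sp n) (v : Fin n ⊕ Fin n → ℂ) :
    x.1.1 *ᵥ quat v = quat (x.1.1 *ᵥ v) := by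
  have h1 : x.1.1 * J (Fin n) ℂ * (x.1.1)ᵀ = J (Fin n) ℂ := SymplecticGroup.mem_iff.mp x.2
  have h2 : (x.1.1)ᵀ * x.1.1.map star = 1 := by
    have := congrArg transpose (UnitaryGroup.star_mul_self x.1)
    rwa [transpose_mul, transpose_one, star_eq_conjTranspose, conjTranspose,
      transpose_map, transpose_transpose] at this
  have h3 : x.1.1 * J (Fin n) ℂ = J (Fin n) ℂ * x.1.1.map star := by
    calc _ = x.1.1 * J (Fin n) ℂ * ((x.1.1)ᵀ * x.1.1.map star) := by rw [h2, mul_one]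
      _ = _ := by rw [← mul_assoc, h1]
  have h4 : star (x.1.1 *ᵥ v) = x.1.1.map star *ᵥ star v := by
    ext i; simp [mulVec, dotProduct]
  rw [quat, quat, h4, mulVec_mulVec, mulVec_mulVec, h3]

/-- The diagonal element of `Sp(n)` with eigenvalues `z i` and their conjugates. -/
noncomputable def diagSp {n : ℕ} (z : Fin n → Circle) : Sp n :=
  ⟨⟨diagonal (Sum.elim (fun i => (z i : ℂ)) fun i => star (z i : ℂ)), by
    rw [mem_unitaryGroup_iff, star_eq_conjTranspose, diagonal_conjTranspose, diagonal_mul_diagonal,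
      ← diagonal_one]
    congr 1
    ext (i | i) <;> simp [Complex.mul_conj, mul_comm]⟩, by
    change diagonal _ ∈ symplecticGroup (Fin n) ℂ
    rw [SymplecticGroup.mem_iff, diagonal_transpose]
    ext (i | i) (j | j) <;> by_cases h : i = j <;>
      simp [J, h, Complex.mul_conj, mul_comm _ (z _ : ℂ), diagonal_mul, mul_diagonal]⟩

lemma coe_diagSp {n : ℕ} (z : Fin n → Circle) : (diagSp z).1.1 =
    diagonal (Sum.elim (fun i => (z i : ℂ)) fun i => star (z i : ℂ)) := rfl

/-- A family of `k` unit vectors which together with their images under `quat` is orthonormal and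
consists of eigenvectors of `x`. -/
structure IsEigenframe {n : ℕ} (x : Sp n) {k : ℕ} (z : Fin k → Circle)
    (v : Fin k → Fin n ⊕ Fin n → ℂ) : Prop where
  inner_eq (i l : Fin k) : star (v i) ⬝ᵥ v l = if i = l then 1 else 0
  inner_quat_eq (i l : Fin k) : star (v i) ⬝ᵥ quat (v l) = 0
  mulVec_eq (i : Fin k) : x.1.1 *ᵥ v i = (z i : ℂ) • v i

lemma IsEigenframe.mulVec_quat_eq {n : ℕ} {x : Sp n} {k : ℕ} {z : Fin k → Circle}
    {v : Fin k → Fin n ⊕ Fin n → ℂ} (h : IsEigenframe x z v) (i : Fin k) :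
    x.1.1 *ᵥ quat (v i) = star (z i : ℂ) • quat (v i) := by
  rw [mulVec_quat, h.mulVec_eq, quat_smul]

lemma IsEigenframe.isConj {n : ℕ} {x : Sp n} {z : Fin n → Circle}
    {v : Fin n → Fin n ⊕ Fin n → ℂ} (h : IsEigenframe x z v) : IsConj (diagSp z) x := by
  let c : Fin n ⊕ Fin n → Fin n ⊕ Fin n → ℂ := Sum.elim v fun i => quat (v i)
  let U : Matrix (Fin n ⊕ Fin n) (Fin n ⊕ Fin n) ℂ := (Matrix.of c)ᵀ
  have hU : U ∈ unitaryGroup (Fin n ⊕ Fin n) ℂ := by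
    rw [mem_unitaryGroup_iff']
    ext a b
    have : (star U * U) a b = star (c a) ⬝ᵥ c b := by
      simp [U, mul_apply, dotProduct, star_apply]
    rw [this]
    rcases a with i | i <;> rcases b with l | l
    · simp [c, h.inner_eq, Matrix.one_apply]
    · simp [c, h.inner_quat_eq]
    · simp [c, star_quat_dotProduct (v i), h.inner_quat_eq]
    · simp [c, star_quat_dotProduct_quat, h.inner_eq, Matrix.one_apply, eq_comm]
  have hS : U ∈ symplecticGroup (Fin n) ℂ := by
    rw [SymplecticGroup.mem_iff']
    ext a b
    have : (Uᵀ * J (Fin n) ℂ * U) a b = star (star (c a) ⬝ᵥ quat (c b)) := by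
      rw [← dotProduct_J_mulVec, Matrix.mul_assoc, mul_apply]
      simp [U, mulVec, dotProduct, mul_apply]
    rw [this]
    rcases a with i | i <;> rcases b with l | l
    · simp [c, h.inner_quat_eq, J]
    · simp [c, h.inner_eq, J, Matrix.one_apply, apply_ite]
    · simp [c, star_quat_dotProduct_quat, h.inner_eq, J, Matrix.one_apply, eq_comm, apply_ite]
    · simp [c, star_quat_dotProduct (v i), h.inner_quat_eq, J]
  refine isConj_iff.mpr ⟨⟨⟨U, hU⟩, hS⟩, mul_inv_eq_iff_eq_mul.mpr ?_⟩
  refine Subtype.ext (Subtype.ext ?_)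
  change U * (diagSp z).1.1 = x.1.1 * U
  ext a b
  have : (x.1.1 * U) a b = (x.1.1 *ᵥ c b) a := by simp [U, mulVec, dotProduct, mul_apply]
  rw [this, coe_diagSp, mul_diagonal]
  rcases b with i | i <;> simp [c, U, h.mulVec_eq, h.mulVec_quat_eq, mul_comm]

lemma star_mulVec_dotProduct_mulVec {n : ℕ} (x : Sp n) (u v : Fin n ⊕ Fin n → ℂ) :
    star (x.1.1 *ᵥ u) ⬝ᵥ x.1.1 *ᵥ v = star u ⬝ᵥ v := by
  rw [star_mulVec, ← dotProduct_mulVec, mulVec_mulVec, ← star_eq_conjTranspose,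
    UnitaryGroup.star_mul_self, one_mulVec]

lemma star_dotProduct_mulVec_eq_zero {n : ℕ} (x : Sp n) {u v : Fin n ⊕ Fin n → ℂ} {c : ℂ}
    (hc : c ≠ 0) (hu : x.1.1 *ᵥ u = c • u) (h : star u ⬝ᵥ v = 0) :
    star u ⬝ᵥ x.1.1 *ᵥ v = 0 := by
  have := star_mulVec_dotProduct_mulVec x u v
  rw [hu, h, star_smul, smul_dotProduct, smul_eq_mul] at this
  exact (mul_eq_zero.mp this).resolve_left (star_ne_zero.mpr hc)

/-- Every proper eigenframe admits an eigenvector orthogonal to it and its image under `quat`. -/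
lemma IsEigenframe.exists_orthogonal {n : ℕ} {x : Sp n} {k : ℕ} {z : Fin k → Circle}
    {v : Fin k → Fin n ⊕ Fin n → ℂ} (h : IsEigenframe x z v) (hk : k < n) :
    ∃ (w : Fin n ⊕ Fin n → ℂ) (c : ℂ), w ≠ 0 ∧ x.1.1 *ᵥ w = c • w ∧
      (∀ i, star (v i) ⬝ᵥ w = 0) ∧ ∀ i, star (quat (v i)) ⬝ᵥ w = 0 := by
  let A : Matrix (Fin k ⊕ Fin k) (Fin n ⊕ Fin n) ℂ :=
    Matrix.of (Sum.elim (fun i => star (v i)) fun i => star (quat (v i)))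
  let W := LinearMap.ker A.mulVecLin
  have memW (w) : w ∈ W ↔ (∀ i, star (v i) ⬝ᵥ w = 0) ∧ ∀ i, star (quat (v i)) ⬝ᵥ w = 0 := by
    simp only [W, LinearMap.mem_ker, mulVecLin_apply, funext_iff, Sum.forall]
    rfl
  have hW : W ≠ ⊥ := LinearMap.ker_ne_bot_of_finrank_lt (by simp; omega)
  have : Nontrivial W := Submodule.nontrivial_iff_ne_bot.mpr hW
  have hmap : ∀ w ∈ W, x.1.1.mulVecLin w ∈ W := by
    intro w hw
    rw [memW] at hw ⊢
    exact ⟨fun i => star_dotProduct_mulVec_eq_zero x (z i).coe_ne_zero (h.mulVec_eq i) (hw.1 i),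
      fun i => star_dotProduct_mulVec_eq_zero x (star_ne_zero.mpr (z i).coe_ne_zero)
        (h.mulVec_quat_eq i) (hw.2 i)⟩
  obtain ⟨c, hc⟩ := Module.End.exists_eigenvalue (x.1.1.mulVecLin.restrict hmap)
  obtain ⟨w, hw⟩ := hc.exists_hasEigenvector
  refine ⟨w, c, by simpa using hw.2, ?_, (memW w).mp w.2⟩
  simpa using congrArg Subtype.val hw.apply_eq_smul

lemma norm_eq_one_of_mulVec_eq {n : ℕ} {x : Sp n} {w : Fin n ⊕ Fin n → ℂ} {c : ℂ}
    (hw : w ≠ 0) (h : x.1.1 *ᵥ w = c • w) : ‖c‖ = 1 := by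
  have h1 := star_mulVec_dotProduct_mulVec x w w
  rw [h, star_smul, smul_dotProduct, dotProduct_smul, smul_smul, smul_eq_mul] at h1
  have h2 : star c * c = 1 := by
    open ComplexOrder in
    exact mul_eq_right₀ (mt dotProduct_star_self_eq_zero.mp hw) |>.mp h1
  have h3 : ‖star c * c‖ = 1 := by rw [h2, norm_one]
  rw [norm_mul, norm_star] at h3
  nlinarith [norm_nonneg c]

lemma exists_normalize {n : ℕ} {w : Fin n ⊕ Fin n → ℂ} (hw : w ≠ 0) :
    ∃ r : ℂ, star (r • w) ⬝ᵥ (r • w) = 1 := by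
  open ComplexOrder in
  have hpos : 0 < star w ⬝ᵥ w := dotProduct_star_self_pos_iff.mpr hw
  obtain ⟨h1, h2⟩ := Complex.pos_iff.mp hpos
  set t := star w ⬝ᵥ w
  have ht : t = (t.re : ℂ) := Complex.ext rfl (by simpa using h2.symm)
  refine ⟨((Real.sqrt t.re)⁻¹ : ℝ), ?_⟩
  have h3 : (Real.sqrt t.re)⁻¹ * (Real.sqrt t.re)⁻¹ * t.re = 1 := by
    rw [← mul_inv, Real.mul_self_sqrt h1.le, inv_mul_cancel₀ h1.ne']
  rw [star_smul, smul_dotProduct, dotProduct_smul, smul_smul, smul_eq_mul]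
  change _ * t = 1
  rw [ht]
  simp only [Complex.star_def, Complex.conj_ofReal]
  exact_mod_cast h3

lemma exists_isEigenframe {n : ℕ} (x : Sp n) (k : ℕ) (hk : k ≤ n) :
    ∃ (z : Fin k → Circle) (v : Fin k → Fin n ⊕ Fin n → ℂ),
      (∀ i, 0 ≤ (z i : ℂ).im) ∧ IsEigenframe x z v := by
  induction k with
  | zero => exact ⟨Fin.elim0, Fin.elim0, fun i => i.elim0, fun i => i.elim0, fun i => i.elim0,
      fun i => i.elim0⟩
  | succ k ih =>
    obtain ⟨z, v, hz, h⟩ := ih (by omega)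
    obtain ⟨w, c, hw, hxw, hvw, hqw⟩ : ∃ (w : Fin n ⊕ Fin n → ℂ) (c : Circle),
        star w ⬝ᵥ w = 1 ∧ x.1.1 *ᵥ w = (c : ℂ) • w ∧
        (∀ i, star (v i) ⬝ᵥ w = 0) ∧ ∀ i, star (quat (v i)) ⬝ᵥ w = 0 := by
      obtain ⟨w, c, hw, hxw, hvw, hqw⟩ := h.exists_orthogonal (by omega)
      obtain ⟨r, hr⟩ := exists_normalize hw
      refine ⟨r • w, ⟨c, mem_sphere_zero_iff_norm.mpr (norm_eq_one_of_mulVec_eq hw hxw)⟩,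
        hr, ?_, ?_, ?_⟩
      · rw [mulVec_smul, hxw, smul_comm]
      · simp [hvw]
      · simp [hqw]
    obtain ⟨w, c, hc, hw, hxw, hvw, hqw⟩ : ∃ (w : Fin n ⊕ Fin n → ℂ) (c : Circle),
        0 ≤ (c : ℂ).im ∧ star w ⬝ᵥ w = 1 ∧ x.1.1 *ᵥ w = (c : ℂ) • w ∧
        (∀ i, star (v i) ⬝ᵥ w = 0) ∧ ∀ i, star (v i) ⬝ᵥ quat w = 0 := by
      have hqw' (i) : star (v i) ⬝ᵥ quat w = 0 := by
        rw [star_dotProduct_quat_comm, star_dotProduct, hqw, star_zero, neg_zero]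
      rcases le_total 0 (c : ℂ).im with hc | hc
      · exact ⟨w, c, hc, hw, hxw, hvw, hqw'⟩
      · refine ⟨quat w, c⁻¹, ?_, ?_, ?_, hqw', ?_⟩
        · rw [Circle.coe_inv_eq_conj]; simpa using hc
        · rw [star_quat_dotProduct_quat, hw]
        · rw [mulVec_quat, hxw, quat_smul, Circle.coe_inv_eq_conj]; rfl
        · simp [hvw]
    refine ⟨Fin.cons c z, Fin.cons w v, ?_, ?_, ?_, ?_⟩
    · exact Fin.cases hc hz
    · intro i l
      refine Fin.cases ?_ (fun i => ?_) i <;> refine Fin.cases ?_ (fun l => ?_) l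
      · simpa using hw
      · simp [(Fin.succ_ne_zero l).symm, star_dotProduct, hvw]
      · simp [hvw]
      · simp [h.inner_eq]
    · intro i l
      refine Fin.cases ?_ (fun i => ?_) i <;> refine Fin.cases ?_ (fun l => ?_) l
      · simp
      · simp [star_dotProduct_quat_comm w, hqw]
      · simp [hqw]
      · simp [h.inner_quat_eq]
    · exact Fin.cases hxw h.mulVec_eq

lemma exists_isConj_diag {n : ℕ} (x : Sp n) :
    ∃ z : Fin n → Circle, (∀ i, 0 ≤ (z i : ℂ).im) ∧ IsConj (diagSp z) x := by
  obtain ⟨z, v, hz, h⟩ := exists_isEigenframe x n le_rfl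
  exact ⟨z, hz, h.isConj⟩

lemma exists_perm_of_map_univ_eq {ι α : Type*} [Fintype ι] {f g : ι → α}
    (h : Finset.univ.val.map f = Finset.univ.val.map g) : ∃ σ : Equiv.Perm ι, f = g ∘ σ := by
  classical
  have e (a : α) : Nonempty ({i // f i = a} ≃ {i // g i = a}) := by
    refine ⟨Fintype.equivOfCardEq ?_⟩
    have := congrArg (Multiset.count a) h
    rw [Multiset.count_map, Multiset.count_map] at this
    rw [Fintype.card_subtype, Fintype.card_subtype]
    simpa only [eq_comm, Finset.card_def, Finset.filter_val] using this
  refine ⟨Equiv.ofFiberEquiv fun a => (e a).some, funext fun i => ?_⟩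
  exact (Equiv.ofFiberEquiv_map _ i).symm

lemma isConj_diag_of_map_eq {n : ℕ} {z w : Fin n → Circle}
    (h : Finset.univ.val.map z = Finset.univ.val.map w) : IsConj (diagSp z) (diagSp w) := by
  obtain ⟨σ, hσ⟩ := exists_perm_of_map_univ_eq h
  have : IsEigenframe (diagSp w) z fun i => Pi.single (Sum.inl (σ i)) 1 := by
    refine ⟨fun i l => ?_, fun i l => ?_, fun i => ?_⟩
    · simp [Pi.single_apply, eq_comm]
    · simp
    · rw [coe_diagSp]
      ext a
      rw [mulVec_diagonal]
      by_cases ha : a = Sum.inl (σ i)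
      · subst ha; simp [hσ]
      · simp [ha]
  exact this.isConj

lemma eq_of_add_map_star_eq {A B : Multiset ℂ} (hA : ∀ a ∈ A, 0 ≤ a.im) (hB : ∀ b ∈ B, 0 ≤ b.im)
    (h : A + A.map star = B + B.map star) : A = B := by
  have key {C : Multiset ℂ} (hC : ∀ a ∈ C, 0 ≤ a.im) {a : ℂ} (ha : 0 < a.im) :
      (C.map star).count a = 0 := by
    rw [Multiset.count_eq_zero, Multiset.mem_map]
    rintro ⟨b, hb, rfl⟩
    have := hC b hb
    simp at ha
    linarith
  have key' (C : Multiset ℂ) {a : ℂ} (ha : a.im = 0) : (C.map star).count a = C.count a := by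
    conv_lhs => rw [← (Complex.conj_eq_iff_im.mpr ha : star a = a)]
    exact Multiset.count_map_eq_count' _ _ star_injective a
  ext a
  have h' := congrArg (Multiset.count a) h
  rw [Multiset.count_add, Multiset.count_add] at h'
  rcases lt_trichotomy a.im 0 with ha | ha | ha
  · rw [Multiset.count_eq_zero_of_notMem fun h => ha.not_ge (hA a h),
      Multiset.count_eq_zero_of_notMem fun h => ha.not_ge (hB a h)]
  · rw [key' A ha, key' B ha] at h'
    omega
  · rwa [key hA ha, key hB ha] at h'

lemma charpoly_eq_of_isConj {n : ℕ} {x y : Sp n} (h : IsConj x y) :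
    x.1.1.charpoly = y.1.1.charpoly := by
  obtain ⟨u, rfl⟩ := isConj_iff.mp h
  have : (u * x * u⁻¹).1.1 = u.1.1 * x.1.1 * u⁻¹.1.1 := rfl
  have h1 : u⁻¹.1.1 * u.1.1 = 1 := congrArg (fun y : Sp n => y.1.1) (inv_mul_cancel u)
  rw [this, charpoly_mul_comm, ← mul_assoc, h1, one_mul]

lemma circle_coe_injective : Function.Injective fun a : Circle => (a : ℂ) :=
  fun _ _ h => Circle.ext h

lemma roots_charpoly_diag {n : ℕ} (z : Fin n → Circle) :
    (diagSp z).1.1.charpoly.roots = Finset.univ.val.map (fun i => (z i : ℂ)) +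
      Finset.univ.val.map fun i => star (z i : ℂ) := by
  rw [coe_diagSp, charpoly_diagonal, Finset.prod_eq_multiset_prod]
  rw [← Function.comp_def (fun a : ℂ => Polynomial.X - Polynomial.C a), ← Multiset.map_map,
    Polynomial.roots_multiset_prod_X_sub_C, ← Finset.univ_disjSum_univ, Finset.val_disjSum,
    Multiset.disjSum, Multiset.map_add]
  simp only [Multiset.map_map]
  rfl

lemma map_eq_of_isConj_diag {n : ℕ} {z w : Fin n → Circle} (hz : ∀ i, 0 ≤ (z i : ℂ).im)
    (hw : ∀ i, 0 ≤ (w i : ℂ).im) (h : IsConj (diagSp z) (diagSp w)) :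
    Finset.univ.val.map z = Finset.univ.val.map w := by
  have h1 := congrArg Polynomial.roots (charpoly_eq_of_isConj h)
  rw [roots_charpoly_diag, roots_charpoly_diag] at h1
  refine Multiset.map_injective circle_coe_injective ?_
  rw [Multiset.map_map, Multiset.map_map]
  refine eq_of_add_map_star_eq ?_ ?_ ?_
  · simpa [-Fin.univ_val_map] using hz
  · simpa [-Fin.univ_val_map] using hw
  · rw [Multiset.map_map, Multiset.map_map]
    exact h1

lemma setOf_mem_spectrum_of_isConj_diag {n : ℕ} {z : Fin n → Circle} {x : Sp n}
    (hz : ∀ i, 0 ≤ (z i : ℂ).im) (h : IsConj (diagSp z) x) :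
    {a : ℂ | a ∈ spectrum ℂ x.1.1 ∧ 0 ≤ a.im} = (fun a : Circle => (a : ℂ)) '' Set.range z := by
  ext a
  rw [Set.mem_ofPred_eq, mem_spectrum_iff_isRoot_charpoly, ← charpoly_eq_of_isConj h,
    ← Polynomial.mem_roots (charpoly_monic _).ne_zero, roots_charpoly_diag]
  simp only [Multiset.mem_add, Multiset.mem_map, Finset.mem_val, Finset.mem_univ, true_and,
    Set.mem_image, Set.mem_range]
  constructor
  · rintro ⟨⟨i, rfl⟩ | ⟨i, rfl⟩, h0⟩
    · exact ⟨_, ⟨i, rfl⟩, rfl⟩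
    · refine ⟨z i, ⟨i, rfl⟩, (Complex.conj_eq_iff_im.mpr (le_antisymm ?_ (hz i))).symm⟩
      simpa using h0
  · rintro ⟨_, ⟨i, rfl⟩, rfl⟩
    exact ⟨Or.inl ⟨i, rfl⟩, hz i⟩

lemma ncard_spectrum_of_isConj_diag [DecidableEq Circle] {n : ℕ} {z : Fin n → Circle} {x : Sp n}
    (hz : ∀ i, 0 ≤ (z i : ℂ).im) (h : IsConj (diagSp z) x) :
    {a : ℂ | a ∈ spectrum ℂ x.1.1 ∧ 0 ≤ a.im}.ncard = (Finset.univ.val.map z).toFinset.card := by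
  rw [setOf_mem_spectrum_of_isConj_diag hz h, Set.ncard_image_of_injective _ circle_coe_injective,
    ← Set.ncard_coe_finset]
  congr 1
  ext a
  simp

lemma pow_eq_one_iff_of_isConj_diag {n : ℕ} {z : Fin n → Circle} {x : Sp n}
    (h : IsConj (diagSp z) x) (m : ℕ) : x ^ m = 1 ↔ ∀ i, z i ^ m = 1 := by
  have h1 : x ^ m = 1 ↔ diagSp z ^ m = 1 := by
    obtain ⟨u, rfl⟩ := isConj_iff.mp h
    rw [conj_pow, conj_eq_one_iff]
  have h2 : diagSp z ^ m = 1 ↔ (diagSp z).1.1 ^ m = 1 := by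
    rw [Subtype.ext_iff, Subtype.ext_iff]
    rfl
  have hstar (a : ℂ) : star a = 1 ↔ a = 1 := map_eq_one_iff (starRingEnd ℂ) star_injective
  rw [h1, h2, coe_diagSp, diagonal_pow, diagonal_eq_one, funext_iff, Sum.forall]
  simp only [Pi.pow_apply, Sum.elim_inl, Sum.elim_inr, Pi.one_apply, ← star_pow,
    hstar, ← Circle.coe_pow, Circle.coe_eq_one, and_self]

lemma ncard_multiset_of_card_toFinset {α : Type*} [DecidableEq α] (T : Finset α) {n s : ℕ}
    (hn : 0 < n) (hs : 0 < s) :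
    {A : Multiset α | A.card = n ∧ A.toFinset ⊆ T ∧ A.toFinset.card = s}.ncard =
      (n - 1).choose (s - 1) * T.card.choose s := by
  rcases lt_or_ge n s with hns | hns
  · rw [Nat.choose_eq_zero_of_lt (by omega), zero_mul]
    convert Set.ncard_empty (Multiset α)
    refine Set.eq_empty_of_forall_notMem ?_
    rintro A ⟨h1, -, h2⟩
    have := A.toFinset_card_le
    omega
  let F (S : Finset α) : Finset (Multiset α) :=
    (S.finsuppAntidiag (n - s)).image fun f => Finsupp.toMultiset f + S.val
  have toFinset_of_mem {S A} (hA : A ∈ F S) : A.toFinset = S := by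
    simp only [F, Finset.mem_image, Finset.mem_finsuppAntidiag] at hA
    obtain ⟨f, ⟨-, hf⟩, rfl⟩ := hA
    rw [Multiset.toFinset_add, Finsupp.toFinset_toMultiset, Finset.val_toFinset]
    exact Finset.union_eq_right.mpr hf
  have card_F {S : Finset α} (hS : S.card = s) : (F S).card = (n - 1).choose (s - 1) := by
    rw [Finset.card_image_of_injective, Finset.card_finsuppAntidiag_nat_eq_choose, hS]
    · rw [show s + (n - s) - 1 = n - 1 by omega]
      exact Nat.choose_symm_of_eq_add (by omega)
    · exact fun f g h => Multiset.toFinsupp.symm.injective (add_right_cancel h)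
  have hset : {A : Multiset α | A.card = n ∧ A.toFinset ⊆ T ∧ A.toFinset.card = s} =
      ((T.powersetCard s).biUnion F : Finset (Multiset α)) := by
    ext A
    simp only [Set.mem_ofPred_eq, Finset.mem_coe, Finset.mem_biUnion, Finset.mem_powersetCard]
    constructor
    · rintro ⟨h1, h2, h3⟩
      have hle : A.toFinset.val ≤ A := by
        rw [Multiset.toFinset_val]; exact Multiset.dedup_le A
      refine ⟨A.toFinset, ⟨h2, h3⟩, Finset.mem_image.mpr
        ⟨Multiset.toFinsupp (A - A.toFinset.val), ?_, ?_⟩⟩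
      · rw [Finset.mem_finsuppAntidiag]
        have hsupp : (Multiset.toFinsupp (A - A.toFinset.val)).support ⊆ A.toFinset := by
          rw [Multiset.toFinsupp_support]
          exact Multiset.toFinset_subset.mpr (Multiset.subset_of_le tsub_le_self)
        refine ⟨?_, hsupp⟩
        have := Multiset.toFinsupp_sum_eq (A - A.toFinset.val)
        rw [Finsupp.sum_of_support_subset _ hsupp _ (by simp), Multiset.card_sub hle, h1] at this
        simpa only [id, Finset.card_val, h3] using this
      · rw [Multiset.toFinsupp_toMultiset, tsub_add_cancel_of_le hle]
    · rintro ⟨S, ⟨h1, h2⟩, hA⟩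
      rw [toFinset_of_mem hA]
      refine ⟨?_, h1, h2⟩
      simp only [F, Finset.mem_image, Finset.mem_finsuppAntidiag] at hA
      obtain ⟨f, ⟨hf1, hf2⟩, rfl⟩ := hA
      rw [Multiset.card_add, Finsupp.card_toMultiset, Finsupp.sum_of_support_subset _ hf2 _ (by simp),
        Finset.card_val, h2]
      simp only [id, hf1]
      omega
  rw [hset, Set.ncard_coe_finset, Finset.card_biUnion,
    Finset.sum_congr rfl fun S hS => card_F (Finset.mem_powersetCard.mp hS).2, Finset.sum_const,
    Finset.card_powersetCard, smul_eq_mul, mul_comm]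
  intro S _ S' _ hne
  refine Finset.disjoint_left.mpr ?_
  exact fun A hA hA' => hne ((toFinset_of_mem hA).symm.trans (toFinset_of_mem hA'))

lemma im_exp_pow (m k : ℕ) : (Circle.exp (2 * Real.pi / m) ^ k : ℂ).im =
    Real.sin (k * (2 * Real.pi / m)) := by
  rw [← Circle.coe_pow, ← Circle.exp_natCast_mul, Circle.coe_exp, Complex.exp_ofReal_mul_I_im]

lemma isPrimitiveRoot_circleExp {m : ℕ} (hm : 0 < m) :
    IsPrimitiveRoot (Circle.exp (2 * Real.pi / m)) m := by
  refine IsPrimitiveRoot.of_map_of_injective (f := Circle.coeHom) ?_ Circle.coe_injective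
  convert Complex.isPrimitiveRoot_exp m hm.ne' using 1
  change (Circle.exp _ : ℂ) = _
  rw [Circle.coe_exp]
  push_cast
  congr 1
  ring

lemma exists_finset_rootsOfUnity_im_nonneg {m : ℕ} (hm : 0 < m) :
    ∃ T : Finset Circle, T.card = m / 2 + 1 ∧ ∀ z, z ∈ T ↔ z ^ m = 1 ∧ 0 ≤ (z : ℂ).im := by
  classical
  have hζ := isPrimitiveRoot_circleExp hm
  set ζ := Circle.exp (2 * Real.pi / m)
  have hm' : (0 : ℝ) < m := by exact_mod_cast hm
  have him (k : ℕ) : (ζ ^ k : ℂ).im = Real.sin (k * (2 * Real.pi / m)) := im_exp_pow m k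
  refine ⟨(Finset.range (m / 2 + 1)).image (ζ ^ ·), ?_, fun z => ?_⟩
  · rw [Finset.card_image_of_injOn, Finset.card_range]
    rcases Nat.lt_or_ge 1 m with h1 | h1
    · intro k hk l hl h
      simp only [Finset.coe_range, Set.mem_Iio] at hk hl
      exact hζ.pow_inj (by omega) (by omega) h
    · intro k hk l hl _
      simp only [Finset.coe_range, Set.mem_Iio] at hk hl
      omega
  · rw [Finset.mem_image]
    constructor
    · rintro ⟨k, hk, rfl⟩
      have hk2 : k * 2 ≤ m := by rw [Finset.mem_range] at hk; omega
      have hk2' : (k : ℝ) * 2 ≤ m := by exact_mod_cast hk2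
      refine ⟨by rw [← pow_mul, mul_comm, pow_mul, hζ.pow_eq_one, one_pow], ?_⟩
      rw [Circle.coe_pow, him]
      refine Real.sin_nonneg_of_nonneg_of_le_pi (by positivity) ?_
      rw [mul_div_assoc', div_le_iff₀ hm']
      nlinarith [Real.pi_pos]
    · rintro ⟨hz, h0⟩
      have : NeZero m := ⟨hm.ne'⟩
      have hζ' : IsPrimitiveRoot (ζ : ℂ) m :=
        hζ.map_of_injective (f := Circle.coeHom) Circle.coe_injective
      obtain ⟨k, hk, hkz⟩ := hζ'.eq_pow_of_pow_eq_one (ξ := (z : ℂ))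
        (by rw [← Circle.coe_pow, hz, Circle.coe_one])
      refine ⟨k, ?_, Circle.coe_injective hkz⟩
      rw [← hkz, him] at h0
      by_contra hk'
      have hk2 : m < k * 2 := by rw [Finset.mem_range] at hk'; omega
      have hk2' : (m : ℝ) < k * 2 := by exact_mod_cast hk2
      have hk3 : (k : ℝ) < m := by exact_mod_cast hk
      have h1 : 0 < Real.sin (k * (2 * Real.pi / m) - Real.pi) := by
        refine Real.sin_pos_of_pos_of_lt_pi ?_ ?_
        · rw [sub_pos, mul_div_assoc', lt_div_iff₀ hm']
          nlinarith [Real.pi_pos]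
        · rw [sub_lt_iff_lt_add, mul_div_assoc', div_lt_iff₀ hm']
          nlinarith [Real.pi_pos]
      rw [Real.sin_sub_pi] at h1
      linarith

lemma exists_map_univ_eq {α : Type*} {n : ℕ} {A : Multiset α} (hA : A.card = n) :
    ∃ z : Fin n → α, Finset.univ.val.map z = A := by
  subst hA
  induction A using Quotient.inductionOn with
  | h l => exact ⟨l.get, (Fin.univ_val_map _).trans (congrArg _ (List.ofFn_get l))⟩

end CompactSymplectic

open CompactSymplectic in
/-- For any positive integers `n`, `m`, `s`, the number of conjugacy classes of `Sp(n)`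
consisting of elements `x` with `x ^ m = 1` and exactly `s` distinct conjugate pairs of
eigenvalues equals `C(n - 1, s - 1) · C(⌊m/2⌋ + 1, s)`. -/
theorem stmt_9 (n m s : ℕ) (hn : 0 < n) (hm : 0 < m) (hs : 0 < s) :
    {c : ConjClasses (Sp n) | ∀ x ∈ c.carrier, x ^ m = 1 ∧
        {z : ℂ | z ∈ spectrum ℂ ((x : Matrix.unitaryGroup (Fin n ⊕ Fin n) ℂ) :
            Matrix (Fin n ⊕ Fin n) (Fin n ⊕ Fin n) ℂ) ∧ 0 ≤ z.im}.ncard = s}.ncard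
      = Nat.choose (n - 1) (s - 1) * Nat.choose (m / 2 + 1) s := by
  classical
  obtain ⟨T, hT, memT⟩ := exists_finset_rootsOfUnity_im_nonneg hm
  rw [← hT, ← ncard_multiset_of_card_toFinset T hn hs]
  have hg (A : Multiset Circle) : A.card = n → ∃ z : Fin n → Circle, Finset.univ.val.map z = A :=
    exists_map_univ_eq
  choose! g hg using hg
  have g_mem {A : Multiset Circle} (h1 : A.card = n) (i : Fin n) : g A i ∈ A := by
    have := Multiset.mem_map_of_mem (g A) (Finset.mem_univ_val i)
    rwa [hg A h1] at this
  have im_nonneg {A : Multiset Circle} (h1 : A.card = n) (h2 : A.toFinset ⊆ T) (i : Fin n) :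
      0 ≤ (g A i : ℂ).im := by
    exact ((memT _).mp (h2 (Multiset.mem_toFinset.mpr (g_mem h1 i)))).2
  rw [← Set.InjOn.ncard_image (f := fun A => ConjClasses.mk (diagSp (g A)))]
  · congr 1
    ext c
    simp only [Set.mem_ofPred_eq, Set.mem_image]
    constructor
    · intro hc
      obtain ⟨x, rfl⟩ := ConjClasses.exists_rep c
      obtain ⟨z, hz, hzx⟩ := exists_isConj_diag x
      obtain ⟨h1, h2⟩ := hc x ConjClasses.mem_carrier_mk
      rw [pow_eq_one_iff_of_isConj_diag hzx] at h1
      rw [ncard_spectrum_of_isConj_diag hz hzx] at h2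
      have hcard : (Finset.univ.val.map z).card = n := by simp
      refine ⟨Finset.univ.val.map z, ⟨hcard, ?_, h2⟩, ?_⟩
      · intro a ha
        obtain ⟨i, -, rfl⟩ := Multiset.mem_map.mp (Multiset.mem_toFinset.mp ha)
        exact (memT _).mpr ⟨h1 i, hz i⟩
      · exact ConjClasses.mk_eq_mk_iff_isConj.mpr ((isConj_diag_of_map_eq (hg _ hcard)).trans hzx)
    · rintro ⟨A, ⟨h1, h2, h3⟩, rfl⟩ x hx
      have hzx : IsConj (diagSp (g A)) x :=
        (ConjClasses.mk_eq_mk_iff_isConj.mp (ConjClasses.mem_carrier_iff_mk_eq.mp hx)).symm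
      rw [ncard_spectrum_of_isConj_diag (im_nonneg h1 h2) hzx, pow_eq_one_iff_of_isConj_diag hzx,
        hg A h1]
      exact ⟨fun i => ((memT _).mp (h2 (Multiset.mem_toFinset.mpr (g_mem h1 i)))).1, h3⟩
  · rintro A ⟨hA1, hA2, -⟩ B ⟨hB1, hB2, -⟩ hAB
    rw [← hg A hA1, ← hg B hB1]
    exact map_eq_of_isConj_diag (im_nonneg hA1 hA2) (im_nonneg hB1 hB2)
      (ConjClasses.mk_eq_mk_iff_isConj.mp hAB)
end

section
/- For any positive integer n and any odd positive integer m, the number of conjugacy classes of the special orthogonal group SO(2n+1) consisting of elements x with x^m = 1 equals C(n + ⌊m/2⌋, ⌊m/2⌋). -/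
open Matrix

/-- The special orthogonal group, as the subgroup of the orthogonal group
`Matrix.orthogonalGroup (Fin k) ℝ` consisting of the elements of determinant `1`. -/
noncomputable def SO (k : ℕ) : Subgroup (Matrix.orthogonalGroup (Fin k) ℝ) where
  carrier := {x | (x : Matrix (Fin k) (Fin k) ℝ).det = 1}
  one_mem' := by simp
  mul_mem' := by
    intro a b ha hb
    simp only [Set.mem_setOf_eq, Matrix.UnitaryGroup.mul_val, Matrix.det_mul] at *
    rw [ha, hb, mul_one]
  inv_mem' := by
    intro a ha
    simp only [Set.mem_setOf_eq, Matrix.UnitaryGroup.inv_val, Matrix.star_eq_conjTranspose,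
      Matrix.det_conjTranspose, star_trivial] at *
    exact ha

/-- The angles `2πj/m`. -/
noncomputable def rotAngle (m : ℕ) (j : Fin (m / 2 + 1)) : ℝ := 2 * Real.pi * j / m

/-- The rotation of the plane by the angle `t`. -/
noncomputable def planeRotation (t : ℝ) : Matrix (Fin 2) (Fin 2) ℝ :=
  !![Real.cos t, -Real.sin t; Real.sin t, Real.cos t]

/-- The block matrix with a rotation by `θ i` for each `i`, and a final fixed vector. -/
noncomputable def rotationForm {ι : Type*} [DecidableEq ι] (θ : ι → ℝ) :
    Matrix (Fin 2 × ι ⊕ Unit) (Fin 2 × ι ⊕ Unit) ℝ :=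
  fromBlocks (blockDiagonal fun i => planeRotation (θ i)) 0 0 1

theorem planeRotation_mul (s t : ℝ) :
    planeRotation s * planeRotation t = planeRotation (s + t) := by
  ext i j
  fin_cases i <;> fin_cases j <;>
    simp [planeRotation, Matrix.mul_apply, Fin.sum_univ_two, Real.cos_add, Real.sin_add] <;> ring

theorem planeRotation_zero : planeRotation 0 = 1 := by
  ext i j
  fin_cases i <;> fin_cases j <;> simp [planeRotation]

theorem planeRotation_transpose (t : ℝ) : (planeRotation t)ᵀ = planeRotation (-t) := by
  ext i j
  fin_cases i <;> fin_cases j <;> simp [planeRotation]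

section rotationForm
variable {ι : Type*} [DecidableEq ι] (θ : ι → ℝ)

theorem rotationForm_mul [Fintype ι] (φ : ι → ℝ) :
    rotationForm θ * rotationForm φ = rotationForm (θ + φ) := by
  simp [rotationForm, fromBlocks_multiply, ← blockDiagonal_mul, planeRotation_mul]

theorem rotationForm_zero : rotationForm (0 : ι → ℝ) = 1 := by
  have : (fun _ : ι => planeRotation 0) = 1 := by
    ext1 i
    exact planeRotation_zero
  simp only [rotationForm, Pi.zero_apply, this, blockDiagonal_one, fromBlocks_one]

theorem rotationForm_transpose : (rotationForm θ)ᵀ = rotationForm (-θ) := by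
  simp [rotationForm, fromBlocks_transpose, blockDiagonal_transpose, planeRotation_transpose]

theorem rotationForm_pow [Fintype ι] (k : ℕ) :
    rotationForm θ ^ k = rotationForm (k • θ) := by
  induction k with
  | zero => simp [rotationForm_zero]
  | succ k ih => rw [pow_succ, ih, rotationForm_mul, succ_nsmul]

theorem rotationForm_add_transpose : rotationForm θ + (rotationForm θ)ᵀ =
    diagonal (Sum.elim (fun x => 2 * Real.cos (θ x.2)) fun _ => 2) := by
  ext (⟨a, i⟩ | i) (⟨b, j⟩ | j)
  · by_cases h : i = j
    · subst h
      fin_cases a <;> fin_cases b <;>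
        simp [rotationForm, planeRotation, blockDiagonal_apply] <;> ring
    · simp [rotationForm, blockDiagonal_apply, h, Ne.symm h]
  · simp [rotationForm]
  · simp [rotationForm]
  · simp [rotationForm]; norm_num

theorem rotationForm_rotAngle_pow [Fintype ι] {m : ℕ} (hm : 0 < m) (j : ι → Fin (m / 2 + 1)) :
    rotationForm (rotAngle m ∘ j) ^ m = 1 := by
  have hm' : (m : ℝ) ≠ 0 := by positivity
  have h (i : ι) : planeRotation ((m • (rotAngle m ∘ j)) i) = 1 := by
    have : (m • (rotAngle m ∘ j)) i = ((j i : ℕ) : ℝ) * (2 * Real.pi) := by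
      simp [rotAngle]
      field_simp
    rw [this, ← planeRotation_zero]
    have hs : Real.sin ((j i : ℕ) * (2 * Real.pi)) = 0 := by
      simpa using Real.sin_add_nat_mul_two_pi 0 (j i)
    simp [planeRotation, hs]
  rw [rotationForm_pow, ← rotationForm_zero]
  simp only [rotationForm, h, Pi.zero_apply, planeRotation_zero]

end rotationForm

theorem rotAngle_cos_injective {m : ℕ} (hm : 0 < m) :
    Function.Injective fun j => Real.cos (rotAngle m j) := by
  have hm' : (0 : ℝ) < m := by positivity
  have hmem (j : Fin (m / 2 + 1)) : rotAngle m j ∈ Set.Icc 0 Real.pi := by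
    refine ⟨by unfold rotAngle; positivity, ?_⟩
    have h : 2 * (j : ℕ) ≤ m := by omega
    have h' : (2 : ℝ) * (j : ℕ) ≤ m := by exact_mod_cast h
    rw [rotAngle, div_le_iff₀ hm']
    nlinarith [Real.pi_pos]
  intro i j hij
  have h := Real.injOn_cos (hmem i) (hmem j) hij
  have hpi := Real.pi_pos
  rw [rotAngle, rotAngle, div_left_inj' hm'.ne'] at h
  have h2 := mul_left_cancel₀ (by positivity) h
  exact Fin.ext (by exact_mod_cast h2)

theorem exists_equiv_comp_eq {α β γ : Type*} [Fintype α] [Fintype β] [DecidableEq γ] {f : α → γ}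
    {g : β → γ} (h : Finset.univ.val.map f = Finset.univ.val.map g) :
    ∃ σ : α ≃ β, g ∘ σ = f := by
  have hc (c : γ) : Fintype.card {a // f a = c} = Fintype.card {b // g b = c} := by
    have := congrArg (Multiset.count c) h
    simp only [Multiset.count_map, ← Finset.filter_val, Finset.card_val] at this
    simpa [Fintype.card_subtype, eq_comm] using this
  exact ⟨Equiv.ofFiberEquiv fun c => Fintype.equivOfCardEq (hc c),
    funext fun a => Equiv.ofFiberEquiv_map _ a⟩

section isometry
variable {V : Type*} [NormedAddCommGroup V] [InnerProductSpace ℝ V]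

open scoped InnerProductSpace

/-- A family of vectors with respect to which `T` has the matrix `rotationForm θ`. -/
def IsRotationFamily {ι : Type*} (T : V →ₗ[ℝ] V) (θ : ι → ℝ) (b : Fin 2 × ι ⊕ Unit → V) : Prop :=
  Orthonormal ℝ b ∧ T (b (.inr ())) = b (.inr ()) ∧ ∀ i,
    T (b (.inl (0, i))) = Real.cos (θ i) • b (.inl (0, i)) + Real.sin (θ i) • b (.inl (1, i)) ∧
    T (b (.inl (1, i))) = -Real.sin (θ i) • b (.inl (0, i)) + Real.cos (θ i) • b (.inl (1, i))

variable {T : V →ₗ[ℝ] V} {m : ℕ}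

theorem inner_pow_pred_left (hT : ∀ a b, ⟪T a, T b⟫_ℝ = ⟪a, b⟫_ℝ) (hm : 0 < m) (hTm : T ^ m = 1)
    (a b : V) : ⟪(T ^ (m - 1)) a, b⟫_ℝ = ⟪a, T b⟫_ℝ := by
  rw [← hT, ← Module.End.mul_apply, ← pow_succ', Nat.sub_add_cancel hm, hTm, Module.End.one_apply]

theorem isSymmetric_add_pow_pred (hT : ∀ a b, ⟪T a, T b⟫_ℝ = ⟪a, b⟫_ℝ) (hm : 0 < m)
    (hTm : T ^ m = 1) : (T + T ^ (m - 1)).IsSymmetric := by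
  intro a b
  rw [LinearMap.add_apply, LinearMap.add_apply, inner_add_left, inner_add_right,
    inner_pow_pred_left hT hm hTm, real_inner_comm, ← inner_pow_pred_left hT hm hTm,
    real_inner_comm, add_comm]

/-- A nontrivial isometry of finite order satisfies a quadratic relation at some vector
it does not fix. -/
theorem exists_apply_apply_eq [FiniteDimensional ℝ V] (hT : ∀ a b, ⟪T a, T b⟫_ℝ = ⟪a, b⟫_ℝ)
    (hm : 0 < m) (hTm : T ^ m = 1) (hT1 : T ≠ 1) :
    ∃ (v : V) (c : ℝ), ‖v‖ = 1 ∧ T v ≠ v ∧ T (T v) = (2 * c) • T v - v := by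
  have hS := isSymmetric_add_pow_pred hT hm hTm
  by_contra! h
  refine hT1 ((hS.eigenvectorBasis rfl).toBasis.ext fun i => ?_)
  rw [OrthonormalBasis.coe_toBasis, Module.End.one_apply]
  by_contra hi
  refine h _ (hS.eigenvalues rfl i / 2) ((hS.eigenvectorBasis rfl).orthonormal.1 i) hi ?_
  have he := congrArg T (hS.apply_eigenvectorBasis rfl i)
  rw [LinearMap.add_apply, map_add, ← Module.End.mul_apply T (T ^ (m - 1)), ← pow_succ',
    Nat.sub_add_cancel hm, hTm, Module.End.one_apply, map_smul] at he
  rw [eq_sub_iff_add_eq, he, mul_div_cancel₀ _ two_ne_zero]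
  rfl

/-- A nontrivial isometry of odd order `m` rotates some plane by an angle `2πj/m`. -/
theorem exists_rotated_plane [FiniteDimensional ℝ V] (hT : ∀ a b, ⟪T a, T b⟫_ℝ = ⟪a, b⟫_ℝ)
    (hodd : Odd m) (hTm : T ^ m = 1) (hT1 : T ≠ 1) :
    ∃ (v w : V) (j : Fin (m / 2 + 1)), ‖v‖ = 1 ∧ ‖w‖ = 1 ∧ ⟪v, w⟫_ℝ = 0 ∧
      T v = Real.cos (rotAngle m j) • v + Real.sin (rotAngle m j) • w ∧
      T w = -Real.sin (rotAngle m j) • v + Real.cos (rotAngle m j) • w := by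
  obtain ⟨v, c, hv, hTv, hTTv⟩ := exists_apply_apply_eq hT hodd.pos hTm hT1
  have hvv : ⟪v, v⟫_ℝ = 1 := by rw [real_inner_self_eq_norm_sq, hv, one_pow]
  have hTvTv : ⟪T v, T v⟫_ℝ = 1 := by rw [hT, hvv]
  have hc : ⟪v, T v⟫_ℝ = c := by
    have h1 : ⟪T v, T (T v)⟫_ℝ = ⟪v, T v⟫_ℝ := hT _ _
    rw [hTTv, inner_sub_right, inner_smul_right, hTvTv, real_inner_comm] at h1
    linarith
  have hu : ‖T v‖ = 1 := by
    rw [norm_eq_sqrt_real_inner, hTvTv, Real.sqrt_one]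
  have hc1 : c < 1 := by
    refine lt_of_le_of_ne (hc ▸ (real_inner_le_norm _ _).trans (by simp [hv, hu])) fun h => hTv ?_
    exact ((inner_eq_one_iff_of_norm_eq_one hv hu).1 (hc.trans h)).symm
  have hc2 : -1 < c := by
    have h1 := neg_le_of_abs_le (abs_real_inner_le_norm v (T v))
    rw [hc, hv, hu, one_mul] at h1
    refine lt_of_le_of_ne h1 fun h => ?_
    have hneg : T v = -v := by
      have h2 : ⟪v, -T v⟫_ℝ = 1 := by rw [inner_neg_right, hc, ← h, neg_neg]
      rw [inner_eq_one_iff_of_norm_eq_one hv (by rwa [norm_neg])] at h2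
      rw [h2, neg_neg, ← h2]
    have hk (k : ℕ) : (T ^ k) v = (-1 : ℝ) ^ k • v := by
      induction k with
      | zero => simp
      | succ k ih => rw [pow_succ, Module.End.mul_apply, hneg, map_neg, ih, pow_succ]; simp
    have h3 := hk m
    rw [hTm, hodd.neg_one_pow, neg_one_smul, Module.End.one_apply] at h3
    have h4 := congrArg (fun x => ⟪v, x⟫_ℝ) h3
    simp only [inner_neg_right, hvv] at h4
    norm_num at h4
  have hs0 : 0 < 1 - c ^ 2 := by nlinarith
  set s := Real.sqrt (1 - c ^ 2) with hs
  have hspos : 0 < s := Real.sqrt_pos.2 hs0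
  have hs2 : s ^ 2 = 1 - c ^ 2 := Real.sq_sqrt hs0.le
  set w := s⁻¹ • (T v - c • v) with hw
  have hTv' : T v = c • v + s • w := by
    rw [hw, smul_inv_smul₀ hspos.ne']
    abel
  have hTw : T w = -s • v + c • w := by
    apply smul_right_injective V hspos.ne'
    have h1 : s • T w = T (T v) - c • T v := by
      rw [hw, map_smul, smul_inv_smul₀ hspos.ne', map_sub, map_smul]
    change s • T w = s • (-s • v + c • w)
    rw [h1, hTTv]
    have h2 : (2 * c) • T v - v - c • T v = c • T v - v := by module
    rw [h2, hTv']
    have h3 : (c ^ 2 - 1) = - s ^ 2 := by rw [hs2]; ring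
    calc c • (c • v + s • w) - v = (c ^ 2 - 1) • v + (c * s) • w := by module
      _ = _ := by rw [h3]; module
  have hvw : ⟪v, w⟫_ℝ = 0 := by
    rw [hw, inner_smul_right, inner_sub_right, inner_smul_right, hc, hvv]
    ring
  have hww : ‖w‖ = 1 := by
    have h1 : ⟪s • w, s • w⟫_ℝ = s ^ 2 := by
      rw [hw, smul_inv_smul₀ hspos.ne', inner_sub_left, inner_sub_right, inner_sub_right,
        inner_smul_left, inner_smul_right, inner_smul_left, inner_smul_right, hTvTv, hvv,
        real_inner_comm, hc, hs2]
      simp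
      ring
    rw [real_inner_self_eq_norm_sq, norm_smul, Real.norm_of_nonneg hspos.le] at h1
    have h2 : ‖w‖ ^ 2 = 1 := by
      have : s ^ 2 ≠ 0 := by positivity
      apply mul_left_cancel₀ this
      linarith [mul_pow s ‖w‖ 2]
    exact (pow_eq_one_iff_of_nonneg (norm_nonneg _) two_ne_zero).1 h2
  set φ := Real.arccos c with hφ
  have hcos : Real.cos φ = c := Real.cos_arccos hc2.le hc1.le
  have hsin : Real.sin φ = s := Real.sin_arccos c
  rw [← hcos, ← hsin] at hTv' hTw
  have hk (k : ℕ) : (T ^ k) v = Real.cos (k * φ) • v + Real.sin (k * φ) • w := by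
    induction k with
    | zero => simp
    | succ k ih =>
      rw [pow_succ', Module.End.mul_apply, ih, map_add, map_smul, map_smul, hTv', hTw]
      push_cast
      rw [add_mul, one_mul, Real.cos_add, Real.sin_add]
      module
  have h1 : Real.cos (m * φ) = 1 := by
    have h2 := congrArg (fun x => ⟪v, x⟫_ℝ) (hk m)
    simp only [hTm, Module.End.one_apply, inner_add_right, inner_smul_right, hvv, hvw] at h2
    linarith
  obtain ⟨j, hj⟩ := (Real.cos_eq_one_iff _).1 h1
  have hm' : (0 : ℝ) < m := by exact_mod_cast hodd.pos
  have hpi := Real.pi_pos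
  have hφ0 : 0 ≤ φ := Real.arccos_nonneg c
  have hφ1 : φ ≤ Real.pi := Real.arccos_le_pi c
  have hj0 : (0 : ℝ) ≤ j := by
    by_contra! hneg
    nlinarith [mul_nonneg hm'.le hφ0]
  have hj1 : (2 : ℝ) * j ≤ m := by
    by_contra! hneg
    nlinarith [mul_le_mul_of_nonneg_left hφ1 hm'.le]
  lift j to ℕ using by exact_mod_cast hj0
  have hj2 : 2 * j ≤ m := by exact_mod_cast hj1
  have hjφ : rotAngle m ⟨j, by omega⟩ = φ := by
    rw [rotAngle, div_eq_iff hm'.ne']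
    push_cast at hj ⊢
    linarith
  exact ⟨v, w, ⟨j, by omega⟩, hv, hww, hvw, by rwa [hjφ], by rwa [hjφ]⟩

theorem IsRotationFamily.cons {n : ℕ} {K : Submodule ℝ V} (hK : ∀ y ∈ K, T y ∈ K)
    {θ : Fin n → ℝ} {b : Fin 2 × Fin n ⊕ Unit → K} (hb : IsRotationFamily (T.restrict hK) θ b)
    {v w : V} {t : ℝ} (hv : ‖v‖ = 1) (hw : ‖w‖ = 1) (hvw : ⟪v, w⟫_ℝ = 0)
    (hKv : ∀ y ∈ K, ⟪v, y⟫_ℝ = 0) (hKw : ∀ y ∈ K, ⟪w, y⟫_ℝ = 0)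
    (hTv : T v = Real.cos t • v + Real.sin t • w)
    (hTw : T w = -Real.sin t • v + Real.cos t • w) :
    ∃ b' : Fin 2 × Fin (n + 1) ⊕ Unit → V, IsRotationFamily T (Fin.cons t θ) b' := by
  obtain ⟨ho, he, hr⟩ := hb
  rw [orthonormal_iff_ite] at ho
  have hvv : ⟪v, v⟫_ℝ = 1 := by rw [real_inner_self_eq_norm_sq, hv, one_pow]
  have hww : ⟪w, w⟫_ℝ = 1 := by rw [real_inner_self_eq_norm_sq, hw, one_pow]
  have hwv : ⟪w, v⟫_ℝ = 0 := by rw [real_inner_comm, hvw]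
  have h1 (x) : ⟪v, (b x : V)⟫_ℝ = 0 := hKv _ (b x).2
  have h2 (x) : ⟪w, (b x : V)⟫_ℝ = 0 := hKw _ (b x).2
  have h3 (x) : ⟪(b x : V), v⟫_ℝ = 0 := by rw [real_inner_comm, h1]
  have h4 (x) : ⟪(b x : V), w⟫_ℝ = 0 := by rw [real_inner_comm, h2]
  refine ⟨Sum.elim (fun x => (Fin.cons (![v, w] x.1) fun i => (b (.inl (x.1, i)) : V) :
    Fin (n + 1) → V) x.2) fun _ => b (.inr ()), ?_, ?_, ?_⟩
  · rw [orthonormal_iff_ite]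
    rintro (⟨a, i⟩ | i) (⟨a', i'⟩ | i')
    · refine Fin.cases ?_ (fun i => ?_) i <;> refine Fin.cases ?_ (fun i' => ?_) i'
      · fin_cases a <;> fin_cases a' <;> simp [hvw, hwv, hv, hw]
      · fin_cases a <;> simp [h1, h2, (Fin.succ_ne_zero _).symm]
      · fin_cases a' <;> simp [h3, h4, Fin.succ_ne_zero]
      · simpa using ho (.inl (a, i)) (.inl (a', i'))
    · refine Fin.cases ?_ (fun i => ?_) i
      · fin_cases a <;> simp [h1, h2]
      · simpa using ho (.inl (a, i)) (.inr ())
    · refine Fin.cases ?_ (fun i' => ?_) i'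
      · fin_cases a' <;> simp [h3, h4]
      · simpa using ho (.inr ()) (.inl (a', i'))
    · simpa using ho (.inr ()) (.inr ())
  · exact congrArg Subtype.val he
  · intro i
    refine Fin.cases ?_ (fun i => ?_) i
    · exact ⟨by simpa using hTv, by simpa using hTw⟩
    · exact ⟨congrArg Subtype.val (hr i).1, congrArg Subtype.val (hr i).2⟩

theorem exists_isRotationFamily_one {n : ℕ} (hV : Module.finrank ℝ V = 2 * n + 1) :
    ∃ b : Fin 2 × Fin n ⊕ Unit → V, IsRotationFamily 1 (0 : Fin n → ℝ) b := by
  have : FiniteDimensional ℝ V := Module.finite_of_finrank_pos (by omega)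
  let e : Fin (Module.finrank ℝ V) ≃ Fin 2 × Fin n ⊕ Unit :=
    Fintype.equivOfCardEq (by simp [hV])
  exact ⟨(stdOrthonormalBasis ℝ V).reindex e, OrthonormalBasis.orthonormal _, rfl, by simp⟩

theorem IsRotationFamily.comp_equiv {ι κ : Type*} {θ : ι → ℝ} {b : Fin 2 × ι ⊕ Unit → V}
    (h : IsRotationFamily T θ b) (σ : κ ≃ ι) :
    IsRotationFamily T (θ ∘ σ)
      (b ∘ Equiv.sumCongr ((Equiv.refl (Fin 2)).prodCongr σ) (Equiv.refl Unit)) :=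
  ⟨h.1.comp _ (Equiv.injective _), h.2.1, fun i => h.2.2 (σ i)⟩

/-- Normal form of an isometry of odd order of an odd-dimensional space. -/
theorem exists_isRotationFamily (hodd : Odd m) (n : ℕ) :
    ∀ {V : Type*} [NormedAddCommGroup V] [InnerProductSpace ℝ V] {T : V →ₗ[ℝ] V},
      Module.finrank ℝ V = 2 * n + 1 → (∀ a b, ⟪T a, T b⟫_ℝ = ⟪a, b⟫_ℝ) → T ^ m = 1 →
      ∃ (j : Fin n → Fin (m / 2 + 1)) (b : Fin 2 × Fin n ⊕ Unit → V),
        IsRotationFamily T (rotAngle m ∘ j) b := by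
  induction n with
  | zero =>
    intro V _ _ T hV hT hTm
    have : FiniteDimensional ℝ V := Module.finite_of_finrank_pos (by omega)
    have hT1 : T = 1 := by
      by_contra hT1
      obtain ⟨v, w, j, hv, hw, hvw, -⟩ := exists_rotated_plane hT hodd hTm hT1
      have ho : Orthonormal ℝ ![v, w] := by simp [orthonormal_vecCons_iff, hv, hw, hvw]
      have := ho.linearIndependent.fintype_card_le_finrank
      simp [hV] at this
    obtain ⟨b, hb⟩ := exists_isRotationFamily_one hV
    exact ⟨0, b, by convert hb⟩
  | succ n ih =>
    intro V _ _ T hV hT hTm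
    have : FiniteDimensional ℝ V := Module.finite_of_finrank_pos (by omega)
    by_cases hT1 : T = 1
    · obtain ⟨b, hb⟩ := exists_isRotationFamily_one hV
      refine ⟨0, b, ?_⟩
      convert hb
      ext i
      simp [rotAngle]
    obtain ⟨v, w, j, hv, hw, hvw, hTv, hTw⟩ := exists_rotated_plane hT hodd hTm hT1
    have ho : Orthonormal ℝ ![v, w] := by simp [orthonormal_vecCons_iff, hv, hw, hvw]
    let W := Submodule.span ℝ (Set.range ![v, w])
    have hmem (y : V) : y ∈ Wᗮ ↔ ⟪v, y⟫_ℝ = 0 ∧ ⟪w, y⟫_ℝ = 0 := by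
      rw [Submodule.mem_orthogonal]
      refine ⟨fun h => ⟨h v (Submodule.subset_span ⟨0, rfl⟩), h w (Submodule.subset_span ⟨1, rfl⟩)⟩,
        fun ⟨h1, h2⟩ u hu => ?_⟩
      induction hu using Submodule.span_induction with
      | mem x hx =>
        obtain ⟨i, rfl⟩ := hx
        fin_cases i
        · exact h1
        · exact h2
      | zero => simp
      | add x y _ _ hx hy => rw [inner_add_left, hx, hy, add_zero]
      | smul a x _ hx => rw [inner_smul_left, hx, mul_zero]
    have hK : ∀ y ∈ Wᗮ, T y ∈ Wᗮ := by
      intro y hy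
      rw [hmem] at hy ⊢
      have h1 : ⟪T v, T y⟫_ℝ = 0 := by rw [hT, hy.1]
      have h2 : ⟪T w, T y⟫_ℝ = 0 := by rw [hT, hy.2]
      rw [hTv, inner_add_left, inner_smul_left, inner_smul_left] at h1
      rw [hTw, inner_add_left, inner_smul_left, inner_smul_left] at h2
      simp only [conj_trivial] at h1 h2
      have h3 := Real.sin_sq_add_cos_sq (rotAngle m j)
      constructor
      · linear_combination Real.cos (rotAngle m j) * h1 - Real.sin (rotAngle m j) * h2
          - ⟪v, T y⟫_ℝ * h3
      · linear_combination Real.sin (rotAngle m j) * h1 + Real.cos (rotAngle m j) * h2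
          - ⟪w, T y⟫_ℝ * h3
    have hW : Module.finrank ℝ W = 2 := finrank_span_eq_card ho.linearIndependent
    have hWK := W.finrank_add_finrank_orthogonal
    obtain ⟨j', b, hb⟩ := ih (T := T.restrict hK) (by omega) (fun a b => hT a b) (by
      rw [Module.End.pow_restrict m hK]
      ext x
      simp [hTm])
    obtain ⟨b', hb'⟩ := hb.cons hK hv hw hvw (fun y hy => ((hmem y).1 hy).1)
      (fun y hy => ((hmem y).1 hy).2) hTv hTw
    refine ⟨Fin.cons j j', b', ?_⟩
    convert hb'
    ext i
    refine Fin.cases ?_ (fun i => ?_) i <;> simp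

theorem IsRotationFamily.apply_eq_sum {ι : Type*} [Fintype ι] [DecidableEq ι] {θ : ι → ℝ}
    {b : Fin 2 × ι ⊕ Unit → V} (h : IsRotationFamily T θ b) (y : Fin 2 × ι ⊕ Unit) :
    T (b y) = ∑ x, rotationForm θ x y • b x := by
  rw [Fintype.sum_sum_type, Fintype.sum_prod_type, Fin.sum_univ_two]
  obtain ⟨-, he, hr⟩ := h
  rcases y with ⟨a, i⟩ | y
  · fin_cases a
    · simp [rotationForm, blockDiagonal_apply, planeRotation, (hr i).1]
    · simp [rotationForm, blockDiagonal_apply, planeRotation, (hr i).2]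
  · simp [rotationForm, he]

end isometry

theorem SO_eq_one_iff {k : ℕ} {x : SO k} :
    x = 1 ↔ (x.1 : Matrix (Fin k) (Fin k) ℝ) = 1 := by
  rw [Subtype.ext_iff, Subtype.ext_iff]
  rfl

theorem SO_val_pow {k : ℕ} (x : SO k) (r : ℕ) :
    ((x ^ r).1 : Matrix (Fin k) (Fin k) ℝ) = (x.1 : Matrix (Fin k) (Fin k) ℝ) ^ r := by
  simp

theorem transpose_mul_self_of_mem_SO {k : ℕ} (x : SO k) :
    (x.1 : Matrix (Fin k) (Fin k) ℝ)ᵀ * x.1 = 1 :=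
  (mem_orthogonalGroup_iff' _ _).1 x.1.2

theorem self_mul_transpose_of_mem_SO {k : ℕ} (x : SO k) :
    (x.1 : Matrix (Fin k) (Fin k) ℝ) * (x.1 : Matrix (Fin k) (Fin k) ℝ)ᵀ = 1 :=
  (mem_orthogonalGroup_iff _ _).1 x.1.2

/-- An orthogonal matrix that intertwines two elements of `SO k`, `k` odd, makes them conjugate. -/
theorem isConj_of_orthogonal_intertwining {k : ℕ} (hk : Odd k) {x y : SO k}
    {Q : Matrix (Fin k) (Fin k) ℝ} (hQ : Qᵀ * Q = 1)
    (h : Q * (x.1 : Matrix (Fin k) (Fin k) ℝ) = y.1 * Q) : IsConj x y := by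
  wlog hd : Q.det = 1 generalizing Q
  · have h1 : Q.det * Q.det = 1 := by
      simpa using congrArg det hQ
    refine this (Q := -Q) (by simpa using hQ) (by simp [h]) ?_
    have h2 : Q.det = -1 := (mul_self_eq_one_iff.1 h1).resolve_left hd
    rw [det_neg, h2, Fintype.card_fin, hk.neg_one_pow]
    norm_num
  let q : SO k := ⟨⟨Q, (mem_orthogonalGroup_iff' _ _).2 hQ⟩, hd⟩
  refine isConj_iff.2 ⟨q, mul_inv_eq_of_eq_mul ?_⟩
  exact Subtype.ext (Subtype.ext h)

theorem roots_charpoly_add_transpose_of_isConj {k : ℕ} {x y : SO k} (h : IsConj x y) :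
    ((x.1 : Matrix (Fin k) (Fin k) ℝ) + (x.1 : Matrix (Fin k) (Fin k) ℝ)ᵀ).charpoly.roots =
      ((y.1 : Matrix (Fin k) (Fin k) ℝ) + (y.1 : Matrix (Fin k) (Fin k) ℝ)ᵀ).charpoly.roots := by
  obtain ⟨c, rfl⟩ := isConj_iff.1 h
  have h1 : ((c * x * c⁻¹).1 : Matrix (Fin k) (Fin k) ℝ) =
    (c.1 : Matrix (Fin k) (Fin k) ℝ) * x.1 * (c.1 : Matrix (Fin k) (Fin k) ℝ)ᵀ := rfl
  rw [h1, transpose_mul, transpose_mul, transpose_transpose, ← Matrix.mul_assoc, ← Matrix.add_mul,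
    ← Matrix.mul_add, charpoly_mul_comm, ← Matrix.mul_assoc, transpose_mul_self_of_mem_SO,
    Matrix.one_mul]

/-- An enumeration of the index set of `rotationForm`. -/
noncomputable def rotationIndexEquiv (n : ℕ) : Fin (2 * n + 1) ≃ Fin 2 × Fin n ⊕ Unit :=
  Fintype.equivOfCardEq (by simp)

/-- The block rotation with angles `2πj/m` as an element of `SO (2n+1)`. -/
noncomputable def rotationSO {n m : ℕ} (hodd : Odd m) (j : Fin n → Fin (m / 2 + 1)) :
    SO (2 * n + 1) := by
  refine ⟨⟨(rotationForm (rotAngle m ∘ j)).submatrix (rotationIndexEquiv n) (rotationIndexEquiv n),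
    (mem_orthogonalGroup_iff _ _).2 ?_⟩, ?_⟩
  · rw [transpose_submatrix,
      submatrix_mul_equiv, rotationForm_transpose, rotationForm_mul, add_neg_cancel,
      rotationForm_zero, submatrix_one_equiv]
  · change det _ = 1
    rw [det_submatrix_equiv_self]
    apply hodd.pow_injective
    simp only [one_pow, ← det_pow, rotationForm_rotAngle_pow hodd.pos, det_one]

theorem rotationSO_val {n m : ℕ} (hodd : Odd m) (j : Fin n → Fin (m / 2 + 1)) :
    ((rotationSO hodd j).1 : Matrix (Fin (2 * n + 1)) (Fin (2 * n + 1)) ℝ) =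
      (rotationForm (rotAngle m ∘ j)).submatrix (rotationIndexEquiv n) (rotationIndexEquiv n) :=
  rfl

theorem submatrix_equiv_pow {α β R : Type*} [Fintype α] [Fintype β] [DecidableEq α]
    [DecidableEq β] [Semiring R] (e : α ≃ β) (A : Matrix β β R) (k : ℕ) :
    A.submatrix e e ^ k = (A ^ k).submatrix e e := by
  induction k with
  | zero => simp
  | succ k ih => rw [pow_succ, ih, submatrix_mul_equiv, pow_succ]

theorem rotationSO_pow {n m : ℕ} (hodd : Odd m) (j : Fin n → Fin (m / 2 + 1)) :
    rotationSO hodd j ^ m = 1 := by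
  rw [SO_eq_one_iff, SO_val_pow, rotationSO_val, submatrix_equiv_pow,
    rotationForm_rotAngle_pow hodd.pos, submatrix_one_equiv]

theorem roots_charpoly_rotationSO_add_transpose {n m : ℕ} (hodd : Odd m)
    (j : Fin n → Fin (m / 2 + 1)) :
    (((rotationSO hodd j).1 : Matrix (Fin (2 * n + 1)) (Fin (2 * n + 1)) ℝ) +
      ((rotationSO hodd j).1 : Matrix (Fin (2 * n + 1)) (Fin (2 * n + 1)) ℝ)ᵀ).charpoly.roots =
      2 • (Finset.univ.val.map j).map (fun i => 2 * Real.cos (rotAngle m i)) + {2} := by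
  have h : (rotationForm (rotAngle m ∘ j)).submatrix (rotationIndexEquiv n) (rotationIndexEquiv n)
      + ((rotationForm (rotAngle m ∘ j)).submatrix (rotationIndexEquiv n)
        (rotationIndexEquiv n))ᵀ =
      reindex (rotationIndexEquiv n).symm (rotationIndexEquiv n).symm
        (rotationForm (rotAngle m ∘ j) + (rotationForm (rotAngle m ∘ j))ᵀ) := rfl
  rw [rotationSO_val, h, charpoly_reindex, rotationForm_add_transpose, charpoly_diagonal,
    Fintype.prod_sum_type, Fintype.prod_prod_type]
  simp only [Sum.elim_inl, Sum.elim_inr, Finset.prod_const, Finset.card_univ, Fintype.card_fin,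
    Fintype.card_unit, pow_one]
  have h2 : (∏ i, (Polynomial.X - Polynomial.C (2 * Real.cos ((rotAngle m ∘ j) i)))) =
      (((Finset.univ.val.map j).map (fun i => 2 * Real.cos (rotAngle m i))).map
        fun a => Polynomial.X - Polynomial.C a).prod := by
    simp only [Finset.prod, Multiset.map_map]
    rfl
  have hX : (Polynomial.X - Polynomial.C (2 : ℝ)) ≠ 0 := Polynomial.X_sub_C_ne_zero _
  have hM : (((Finset.univ.val.map j).map (fun i => 2 * Real.cos (rotAngle m i))).map
        fun a => Polynomial.X - Polynomial.C a).prod.Monic :=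
    Polynomial.monic_multiset_prod_of_monic _ _ fun a _ => Polynomial.monic_X_sub_C a
  rw [h2, Polynomial.roots_mul (mul_ne_zero (pow_ne_zero _ hM.ne_zero) hX), Polynomial.roots_pow,
    Polynomial.roots_multiset_prod_X_sub_C, Polynomial.roots_X_sub_C]

theorem map_eq_of_isConj_rotationSO {n m : ℕ} (hodd : Odd m) {j j' : Fin n → Fin (m / 2 + 1)}
    (h : IsConj (rotationSO hodd j) (rotationSO hodd j')) :
    Finset.univ.val.map j = Finset.univ.val.map j' := by
  have h1 := roots_charpoly_add_transpose_of_isConj h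
  rw [roots_charpoly_rotationSO_add_transpose, roots_charpoly_rotationSO_add_transpose,
    add_left_inj] at h1
  refine Multiset.map_injective (f := fun i => 2 * Real.cos (rotAngle m i))
    (fun a b hab => rotAngle_cos_injective hodd.pos (mul_left_cancel₀ two_ne_zero hab)) ?_
  ext a
  have h2 := congrArg (Multiset.count a) h1
  simpa only [Multiset.count_nsmul, mul_right_inj' two_ne_zero] using h2

theorem exists_isConj_rotationSO {n m : ℕ} (hodd : Odd m) {x : SO (2 * n + 1)} (hx : x ^ m = 1) :
    ∃ j : Fin n → Fin (m / 2 + 1), ∀ j', Finset.univ.val.map j' = Finset.univ.val.map j →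
      IsConj (rotationSO hodd j') x := by
  set A : Matrix (Fin (2 * n + 1)) (Fin (2 * n + 1)) ℝ := x.1.1 with hA
  have hAm : A ^ m = 1 := by rw [hA, ← SO_val_pow, hx]; rfl
  have hT (a b : EuclideanSpace ℝ (Fin (2 * n + 1))) :
      inner ℝ (toEuclideanLin A a) (toEuclideanLin A b) = inner ℝ a b := by
    simp only [EuclideanSpace.inner_eq_star_dotProduct, star_trivial, toLpLin_apply]
    rw [dotProduct_mulVec, ← mulVec_transpose, mulVec_mulVec, hA, transpose_mul_self_of_mem_SO,
      one_mulVec]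
  obtain ⟨j, b, hb⟩ := exists_isRotationFamily hodd n (T := toEuclideanLin A) (by simp) hT
    (by rw [← toLpLin_pow, hAm, toLpLin_one]; rfl)
  refine ⟨j, fun j' hj' => ?_⟩
  obtain ⟨σ, hσ⟩ := exists_equiv_comp_eq hj'
  obtain ⟨b, hb⟩ : ∃ b, IsRotationFamily (toEuclideanLin A) (rotAngle m ∘ j') b :=
    ⟨_, by simpa only [Function.comp_assoc, hσ] using hb.comp_equiv σ⟩
  have ho := orthonormal_iff_ite.1 hb.1
  let e := rotationIndexEquiv n
  refine isConj_of_orthogonal_intertwining ⟨n, rfl⟩ (Q := of fun a c => b (e c) a) ?_ ?_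
  · ext c d
    have := ho (e c) (e d)
    simp only [EuclideanSpace.inner_eq_star_dotProduct, star_trivial, e.injective.eq_iff] at this
    rw [one_apply, ← this, dotProduct_comm]
    rfl
  · ext a c
    have h1 := congrArg (fun v : EuclideanSpace ℝ (Fin (2 * n + 1)) => v a)
      (hb.apply_eq_sum (e c))
    rw [← Equiv.sum_comp e] at h1
    simp only [toLpLin_apply] at h1
    rw [rotationSO_val]
    simp only [Matrix.mul_apply, of_apply, submatrix_apply]
    simp only [mulVec, dotProduct, PiLp.smul_apply, WithLp.ofLp_sum, Finset.sum_apply,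
      smul_eq_mul] at h1
    refine Eq.trans ?_ h1.symm
    simp [mul_comm, e]

/-- For any positive integer `n` and odd positive integer `m`, the number of conjugacy
classes of `SO(2n+1)` consisting of elements `x` with `x ^ m = 1` equals
`C(n + ⌊m/2⌋, ⌊m/2⌋)`. -/
theorem stmt_10 (n m : ℕ) (hn : 0 < n) (hm : 0 < m) (hodd : Odd m) :
    {c : ConjClasses (SO (2 * n + 1)) | ∀ x ∈ c.carrier, x ^ m = 1}.ncard
      = Nat.choose (n + m / 2) (m / 2) := by
  have hrep (s : Sym (Fin (m / 2 + 1)) n) :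
      ∃ j : Fin n → Fin (m / 2 + 1), Finset.univ.val.map j = s.1 := by
    obtain ⟨⟨l⟩, hl⟩ := s
    have hl' : l.length = n := hl
    subst hl'
    refine ⟨l.get, ?_⟩
    simp [Fin.univ_val_map]
  choose J hJ using hrep
  let Φ (s : Sym (Fin (m / 2 + 1)) n) : ConjClasses (SO (2 * n + 1)) :=
    ConjClasses.mk (rotationSO hodd (J s))
  have hΦ : Function.Injective Φ := by
    intro s t hst
    have h := map_eq_of_isConj_rotationSO hodd (ConjClasses.mk_eq_mk_iff_isConj.1 hst)
    exact Subtype.ext (by rw [← hJ, ← hJ, h])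
  have hrange : {c : ConjClasses (SO (2 * n + 1)) | ∀ x ∈ c.carrier, x ^ m = 1} = Set.range Φ := by
    ext c
    constructor
    · intro hc
      obtain ⟨x, rfl⟩ := ConjClasses.exists_rep c
      obtain ⟨j, hj⟩ := exists_isConj_rotationSO hodd (hc x ConjClasses.mem_carrier_mk)
      let s : Sym (Fin (m / 2 + 1)) n := ⟨Finset.univ.val.map j, by simp⟩
      exact ⟨s, ConjClasses.mk_eq_mk_iff_isConj.2 (hj _ (hJ s))⟩
    · rintro ⟨s, rfl⟩ x hx
      rw [ConjClasses.mem_carrier_iff_mk_eq, ConjClasses.mk_eq_mk_iff_isConj] at hx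
      have h := hx.symm.pow m
      rw [rotationSO_pow, isConj_one_right] at h
      exact h
  rw [hrange, ← Nat.card_coe_set_eq, Nat.card_range_of_injective hΦ, Nat.card_eq_fintype_card,
    Sym.card_sym_eq_choose, Fintype.card_fin, ← Nat.choose_symm_add]
  congr 1
  omega
end

section
/- For any positive integer n and any odd positive integer m, the number of conjugacy classes of the full orthogonal group O(2n) consisting of elements x with x^m = 1 equals C(n + ⌊m/2⌋, ⌊m/2⌋). -/
open Matrix

theorem planeRotation_pow (t : ℝ) (m : ℕ) :
    planeRotation t ^ m = planeRotation (m * t) := by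
  induction m with
  | zero => simp [planeRotation_zero]
  | succ m ih =>
    rw [pow_succ, ih, planeRotation_mul]
    congr 1
    push_cast
    ring

theorem planeRotation_two_pi_mul_nat (j : ℕ) : planeRotation (j * (2 * Real.pi)) = 1 := by
  rw [← planeRotation_pow]
  have : planeRotation (2 * Real.pi) = 1 := by
    rw [← planeRotation_zero]
    simp [planeRotation]
  rw [this, one_pow]

/-- The rotation angle `2πj/m`. -/
noncomputable def rootAngle (m j : ℕ) : ℝ := j * (2 * Real.pi) / m

theorem rootAngle_mem_Icc {m j : ℕ} (hm : 0 < m) (hj : j ≤ m / 2) :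
    rootAngle m j ∈ Set.Icc 0 Real.pi := by
  have hm' : (0 : ℝ) < m := by exact_mod_cast hm
  have h : (2 * j : ℝ) ≤ m := by exact_mod_cast (by omega : 2 * j ≤ m)
  have hpi := Real.pi_pos
  refine ⟨by unfold rootAngle; positivity, ?_⟩
  rw [rootAngle, div_le_iff₀ hm']
  nlinarith

theorem cos_rootAngle_injective {m : ℕ} (hm : 0 < m) :
    Function.Injective fun j : Fin (m / 2 + 1) => 2 * Real.cos (rootAngle m j) := by
  intro i j h
  have hm' : (m : ℝ) ≠ 0 := by exact_mod_cast hm.ne'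
  have h' := Real.injOn_cos (rootAngle_mem_Icc hm (Nat.lt_succ_iff.1 i.2))
    (rootAngle_mem_Icc hm (Nat.lt_succ_iff.1 j.2)) (mul_left_cancel₀ two_ne_zero h)
  have hpi := Real.pi_ne_zero
  simp only [rootAngle] at h'
  field_simp at h'
  exact Fin.ext (by exact_mod_cast h')

/-- An angle in `[0, π]` whose `m`-th multiple is trivial is one of the angles `2πj/m`. -/
theorem exists_rootAngle_eq {m : ℕ} (hm : 0 < m) {t : ℝ} (h0 : 0 ≤ t) (hpi : t ≤ Real.pi)
    (h : Real.cos (m * t) = 1) : ∃ j : Fin (m / 2 + 1), t = rootAngle m j := by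
  obtain ⟨k, hk⟩ := (Real.cos_eq_one_iff _).1 h
  have hm' : (0 : ℝ) < m := by exact_mod_cast hm
  have hp := Real.pi_pos
  have hk0 : (0 : ℝ) ≤ k := by
    by_contra! hlt
    nlinarith [mul_nonneg hm'.le h0]
  lift k to ℕ using (by exact_mod_cast hk0)
  push_cast at hk hk0
  have hle : (2 * k : ℝ) ≤ m := by
    by_contra! hlt
    nlinarith [mul_le_mul_of_nonneg_left hpi hm'.le]
  have hle' : 2 * k ≤ m := by exact_mod_cast hle
  refine ⟨⟨k, by omega⟩, ?_⟩
  rw [rootAngle, eq_div_iff hm'.ne']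
  linarith

/-- The block-diagonal matrix whose blocks are the rotations by `2πj/m`, with `j` in the
family `f`. -/
noncomputable def rotationBlocks {n m : ℕ} (f : Fin n → Fin (m / 2 + 1)) :
    Matrix (Fin 2 × Fin n) (Fin 2 × Fin n) ℝ :=
  blockDiagonal fun i => planeRotation (rootAngle m (f i))

theorem rotationBlocks_transpose_mul {n m : ℕ} (f : Fin n → Fin (m / 2 + 1)) :
    (rotationBlocks f)ᵀ * rotationBlocks f = 1 := by
  simp [rotationBlocks, blockDiagonal_transpose, ← blockDiagonal_mul, planeRotation_transpose,
    planeRotation_mul, planeRotation_zero, ← Pi.one_def]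

theorem rotationBlocks_pow {n m : ℕ} (hm : 0 < m) (f : Fin n → Fin (m / 2 + 1)) :
    rotationBlocks f ^ m = 1 := by
  have hm' : (m : ℝ) ≠ 0 := by exact_mod_cast hm.ne'
  rw [rotationBlocks, ← blockDiagonal_pow, ← blockDiagonal_one]
  congr 1
  funext i
  rw [Pi.pow_apply, planeRotation_pow, rootAngle, mul_div_cancel₀ _ hm',
    planeRotation_two_pi_mul_nat, Pi.one_apply]

theorem rotationBlocks_add_transpose {n m : ℕ} (f : Fin n → Fin (m / 2 + 1)) :
    rotationBlocks f + (rotationBlocks f)ᵀ =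
      diagonal fun p => 2 * Real.cos (rootAngle m (f p.2)) := by
  ext ⟨a, i⟩ ⟨b, j⟩
  by_cases h : i = j
  · subst h
    fin_cases a <;> fin_cases b <;>
      simp [rotationBlocks, blockDiagonal_apply, planeRotation, two_mul]
  · simp [rotationBlocks, blockDiagonal_apply, h]

theorem charpoly_rotationBlocks_add_transpose_roots {n m : ℕ} (f : Fin n → Fin (m / 2 + 1)) :
    (rotationBlocks f + (rotationBlocks f)ᵀ).charpoly.roots =
      2 • (Finset.univ.val.map f).map
        fun j : Fin (m / 2 + 1) => 2 * Real.cos (rootAngle m j) := by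
  rw [rotationBlocks_add_transpose, charpoly_diagonal, Fintype.prod_prod_type,
    Fin.prod_univ_two, ← pow_two, Polynomial.roots_pow, Multiset.map_map]
  congr 1
  rw [← Polynomial.roots_multiset_prod_X_sub_C (Multiset.map _ _), Multiset.map_map]
  rfl

/-- An identification of the index set of `rotationBlocks` with `Fin (2 * n)`. -/
def blockIndexEquiv (n : ℕ) : Fin 2 × Fin n ≃ Fin (2 * n) := finProdFinEquiv

/-- The matrix `rotationBlocks f` as an element of the orthogonal group. -/
noncomputable def orthogonalRotationBlocks {n m : ℕ} (f : Fin n → Fin (m / 2 + 1)) :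
    orthogonalGroup (Fin (2 * n)) ℝ :=
  ⟨(rotationBlocks f).submatrix (blockIndexEquiv n).symm (blockIndexEquiv n).symm, by
    rw [mem_orthogonalGroup_iff', transpose_submatrix, submatrix_mul_equiv,
      rotationBlocks_transpose_mul, submatrix_one_equiv]⟩

theorem orthogonalRotationBlocks_pow {n m : ℕ} (hm : 0 < m) (f : Fin n → Fin (m / 2 + 1)) :
    orthogonalRotationBlocks f ^ m = 1 := by
  apply Subtype.ext
  have h := congrArg (reindexAlgEquiv ℝ ℝ (blockIndexEquiv n)) (rotationBlocks_pow hm f)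
  rw [map_pow, map_one] at h
  exact h

theorem map_univ_eq_of_isConj {n m : ℕ} (hm : 0 < m) {f g : Fin n → Fin (m / 2 + 1)}
    (h : IsConj (orthogonalRotationBlocks f) (orthogonalRotationBlocks g)) :
    Finset.univ.val.map f = Finset.univ.val.map g := by
  obtain ⟨c, hc⟩ := isConj_iff.1 h
  have hc' : (c : Matrix (Fin (2 * n)) (Fin (2 * n)) ℝ) * (orthogonalRotationBlocks f).1 * c.1ᵀ =
      (orthogonalRotationBlocks g).1 := congrArg Subtype.val hc
  have hcc : c.1ᵀ * c.1 = 1 := (mem_orthogonalGroup_iff' _ _).1 c.2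
  have key : ((orthogonalRotationBlocks g).1 + (orthogonalRotationBlocks g).1ᵀ).charpoly =
      ((orthogonalRotationBlocks f).1 + (orthogonalRotationBlocks f).1ᵀ).charpoly := by
    rw [← hc', transpose_mul, transpose_mul, transpose_transpose, ← mul_assoc, ← add_mul,
      ← mul_add, charpoly_mul_comm, ← mul_assoc, hcc, one_mul]
  have hsub (f : Fin n → Fin (m / 2 + 1)) :
      ((orthogonalRotationBlocks f).1 + (orthogonalRotationBlocks f).1ᵀ).charpoly =
        (rotationBlocks f + (rotationBlocks f)ᵀ).charpoly :=
    charpoly_reindex (blockIndexEquiv n) (rotationBlocks f + (rotationBlocks f)ᵀ)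
  rw [hsub, hsub] at key
  have hr := congrArg Polynomial.roots key
  rw [charpoly_rotationBlocks_add_transpose_roots,
    charpoly_rotationBlocks_add_transpose_roots] at hr
  apply Multiset.map_injective (cos_rootAngle_injective hm)
  ext r
  have := congrArg (Multiset.count r) hr
  simp only [Multiset.count_nsmul] at this
  omega

/-- An orthonormal family in which `x` acts by the rotation blocks `rotationBlocks f`. -/
structure IsRotationFrame {n m r : ℕ} (x : Matrix (Fin n) (Fin n) ℝ)
    (f : Fin r → Fin (m / 2 + 1)) (v : Fin 2 × Fin r → Fin n → ℝ) : Prop where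
  dotProduct_eq : ∀ p q, v p ⬝ᵥ v q = if p = q then 1 else 0
  mulVec_eq : ∀ b i, x *ᵥ v (b, i) = ∑ a, planeRotation (rootAngle m (f i)) a b • v (a, i)

theorem IsRotationFrame.comp_perm {n m r : ℕ} {x : Matrix (Fin n) (Fin n) ℝ}
    {f : Fin r → Fin (m / 2 + 1)} {v : Fin 2 × Fin r → Fin n → ℝ} (h : IsRotationFrame x f v)
    (e : Equiv.Perm (Fin r)) : IsRotationFrame x (f ∘ e) fun p => v (p.1, e p.2) where
  dotProduct_eq p q := by simp [h.dotProduct_eq, Prod.ext_iff]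
  mulVec_eq b i := h.mulVec_eq b (e i)

theorem IsRotationFrame.isConj {n m : ℕ} {x : orthogonalGroup (Fin (2 * n)) ℝ}
    {f : Fin n → Fin (m / 2 + 1)} {v : Fin 2 × Fin n → Fin (2 * n) → ℝ}
    (h : IsRotationFrame x.1 f v) : IsConj (orthogonalRotationBlocks f) x := by
  set P : Matrix (Fin (2 * n)) (Fin 2 × Fin n) ℝ := Matrix.of fun a p => v p a with hP
  have hPP : Pᵀ * P = 1 := by
    ext p q
    simpa [hP, Matrix.mul_apply, dotProduct, Matrix.one_apply] using h.dotProduct_eq p q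
  have hxP : x.1 * P = P * rotationBlocks f := by
    ext a ⟨b, i⟩
    have := congrFun (h.mulVec_eq b i) a
    simp only [Matrix.mul_apply, mulVec, dotProduct, Finset.sum_apply, Pi.smul_apply,
      smul_eq_mul, hP, Matrix.of_apply, rotationBlocks, blockDiagonal_apply,
      Fintype.sum_prod_type] at this ⊢
    rw [this]
    simp [mul_comm]
  let U : orthogonalGroup (Fin (2 * n)) ℝ := ⟨P.submatrix id (blockIndexEquiv n).symm, by
    rw [mem_orthogonalGroup_iff', transpose_submatrix,
      submatrix_mul _ _ _ id _ Function.bijective_id |>.symm, hPP, submatrix_one_equiv]⟩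
  refine isConj_iff.2 ⟨U, ?_⟩
  rw [mul_inv_eq_iff_eq_mul]
  apply Subtype.ext
  change P.submatrix id _ * (rotationBlocks f).submatrix _ _ = x.1 * P.submatrix id _
  rw [submatrix_mul_equiv, ← hxP, submatrix_mul _ _ _ id _ Function.bijective_id,
    submatrix_id_id]

theorem isRotationFrame_orthogonalRotationBlocks {n m : ℕ} (f : Fin n → Fin (m / 2 + 1)) :
    IsRotationFrame (orthogonalRotationBlocks f).1 f
      fun p => Pi.single (blockIndexEquiv n p) 1 where
  dotProduct_eq p q := by
    simp [Pi.single_apply, eq_comm]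
  mulVec_eq b i := by
    ext c
    obtain ⟨⟨a, j⟩, rfl⟩ := (blockIndexEquiv n).surjective c
    simp only [orthogonalRotationBlocks, mulVec_single_one, col_apply, submatrix_apply,
      Equiv.symm_apply_apply, rotationBlocks, blockDiagonal_apply, Finset.sum_apply,
      Pi.smul_apply, Pi.single_apply, EmbeddingLike.apply_eq_iff_eq, Prod.mk.injEq, smul_eq_mul]
    by_cases h : j = i <;> simp [h]

theorem exists_perm_of_map_univ_eq {ι α : Type*} [Fintype ι] [DecidableEq α] {f g : ι → α}
    (h : Finset.univ.val.map f = Finset.univ.val.map g) : ∃ e : Equiv.Perm ι, g ∘ e = f := by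
  have hcard (c : α) : Fintype.card {i // f i = c} = Fintype.card {i // g i = c} := by
    have := congrArg (Multiset.count c) h
    simp only [Multiset.count_map] at this
    simpa [Fintype.card_subtype, Finset.card_def, eq_comm] using this
  refine ⟨Equiv.ofFiberEquiv fun c => Fintype.equivOfCardEq (hcard c), ?_⟩
  funext i
  exact Equiv.ofFiberEquiv_map _ i

theorem mk_orthogonalRotationBlocks_eq_iff {n m : ℕ} (hm : 0 < m)
    {f g : Fin n → Fin (m / 2 + 1)} :
    ConjClasses.mk (orthogonalRotationBlocks f) = ConjClasses.mk (orthogonalRotationBlocks g) ↔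
      Finset.univ.val.map f = Finset.univ.val.map g := by
  rw [ConjClasses.mk_eq_mk_iff_isConj]
  refine ⟨map_univ_eq_of_isConj hm, fun h => ?_⟩
  obtain ⟨e, rfl⟩ := exists_perm_of_map_univ_eq h
  exact ((isRotationFrame_orthogonalRotationBlocks g).comp_perm e).isConj

section RotationPlanes

variable {V : Type*} [NormedAddCommGroup V] [InnerProductSpace ℝ V] [FiniteDimensional ℝ V]

/-- A linear isometry of odd finite order on a space of dimension at least two rotates some
oriented orthonormal pair. -/
theorem exists_rotation_pair {m : ℕ} (hodd : Odd m) (hV : 2 ≤ Module.finrank ℝ V)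
    (T : V →ₗ[ℝ] V) (hT : ∀ v w, inner ℝ (T v) (T w) = inner ℝ v w) (hTm : T ^ m = 1) :
    ∃ (j : Fin (m / 2 + 1)) (e : Fin 2 → V), Orthonormal ℝ e ∧
      ∀ b, T (e b) = ∑ a, planeRotation (rootAngle m j) a b • e a := by
  obtain ⟨k, rfl⟩ : ∃ k, m = k + 1 := ⟨m - 1, by have := hodd.pos; omega⟩
  have hTk (v : V) : T ((T ^ k) v) = v := by
    rw [← Module.End.mul_apply, ← pow_succ', hTm, Module.End.one_apply]
  have hadj (v w : V) : inner ℝ (T v) w = inner ℝ v ((T ^ k) w) := by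
    rw [← hT v, hTk]
  have hS : (T + T ^ k).IsSymmetric := fun v w => by
    rw [LinearMap.add_apply, LinearMap.add_apply, inner_add_left, inner_add_right, hadj v w,
      add_comm, real_inner_comm, ← hadj w v, real_inner_comm]
  have hnorm (v : V) : ‖T v‖ = ‖v‖ := by
    rw [@norm_eq_sqrt_real_inner V, @norm_eq_sqrt_real_inner V, hT]
  set b := hS.eigenvectorBasis rfl with hb
  by_cases hfix : ∀ i, T (b i) = b i
  · have hT1 : T = 1 := b.toBasis.ext fun i => by simpa using hfix i
    refine ⟨0, b ∘ Fin.castLE hV, b.orthonormal.comp _ (Fin.castLE_injective hV), fun a => ?_⟩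
    have h0 : rootAngle (k + 1) ((0 : Fin ((k + 1) / 2 + 1)) : ℕ) = 0 := by simp [rootAngle]
    rw [h0, planeRotation_zero, hT1]
    simp [Matrix.one_apply]
  · push Not at hfix
    obtain ⟨i, hi⟩ := hfix
    have hv1 : ‖b i‖ = 1 := b.orthonormal.1 i
    have hSv := hS.apply_eigenvectorBasis rfl i
    rw [← hb] at hSv
    generalize b i = v at hi hv1 hSv
    generalize (hS.eigenvalues rfl i) = μ at hSv
    simp only [LinearMap.add_apply, RCLike.ofReal_real_eq_id, id_eq] at hSv
    have hTv1 : ‖T v‖ = 1 := by rw [hnorm, hv1]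
    have hvv : inner ℝ v v = (1 : ℝ) := by rw [real_inner_self_eq_norm_sq, hv1, one_pow]
    set c : ℝ := inner ℝ v (T v) with hc
    have hμ : μ = 2 * c := by
      have := congrArg (inner ℝ v) hSv
      rw [inner_add_right, ← hadj, inner_smul_right, hvv, real_inner_comm v (T v), ← hc] at this
      linarith
    have hTT : T (T v) = (2 * c) • T v - v := by
      have := congrArg T hSv
      rw [map_add, hTk, map_smul, hμ] at this
      exact eq_sub_of_add_eq this
    have hc1 : c ≠ 1 := fun h =>
      hi ((inner_eq_one_iff_of_norm_eq_one (𝕜 := ℝ) hv1 hTv1).1 h).symm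
    have hcm1 : c ≠ -1 := fun h => by
      have h1 : inner ℝ v (-T v) = (1 : ℝ) := by rw [inner_neg_right, ← hc, h, neg_neg]
      have h2 : v = -T v :=
        (inner_eq_one_iff_of_norm_eq_one (𝕜 := ℝ) hv1 (by rw [norm_neg, hTv1])).1 h1
      have h3 : T v = -v := by rw [eq_neg_iff_add_eq_zero, ← eq_neg_iff_add_eq_zero.1 h2, add_comm]
      have h4 (l : ℕ) : (T ^ l) v = (-1 : ℝ) ^ l • v := by
        induction l with
        | zero => simp
        | succ l ih => rw [pow_succ', Module.End.mul_apply, ih, map_smul, h3, pow_succ]; simp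
      have h5 := h4 (k + 1)
      rw [hTm, hodd.neg_one_pow, Module.End.one_apply, neg_one_smul] at h5
      have : v = 0 := by
        have h6 : (2 : ℝ) • v = 0 := by rw [two_smul]; exact eq_neg_iff_add_eq_zero.1 h5
        exact (smul_eq_zero.1 h6).resolve_left two_ne_zero
      rw [this, norm_zero] at hv1
      exact zero_ne_one hv1
    have hcabs : |c| ≤ 1 := by
      have := abs_real_inner_le_norm v (T v)
      rwa [hv1, hTv1, one_mul] at this
    obtain ⟨hcl, hcu⟩ := abs_le.1 hcabs
    set t := Real.arccos c with ht
    have hcos : Real.cos t = c := Real.cos_arccos hcl hcu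
    have hsin : 0 < Real.sin t := by
      rw [ht, Real.sin_arccos]
      apply Real.sqrt_pos.2
      have h1 := lt_of_le_of_ne hcu hc1
      have h2 := lt_of_le_of_ne hcl hcm1.symm
      nlinarith
    set s := Real.sin t with hs
    have hcs : s ^ 2 + c ^ 2 = 1 := by rw [← hcos]; exact Real.sin_sq_add_cos_sq t
    set w := s⁻¹ • (T v - c • v) with hw
    have hTv : T v = c • v + s • w := by
      rw [hw, smul_inv_smul₀ hsin.ne']; abel
    have hsw : s • w = T v - c • v := by rw [hw, smul_inv_smul₀ hsin.ne']
    have hTw : T w = (-s) • v + c • w := by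
      have h1 : s • T w = s • ((-s) • v + c • w) := by
        rw [← map_smul, hsw, map_sub, map_smul, hTT, smul_add, smul_comm s c w, hsw]
        have h2 : s • (-s) • v = (c ^ 2 - 1) • v := by
          rw [smul_smul]; congr 1; linarith
        rw [h2]
        module
      exact smul_right_injective V hsin.ne' h1
    have hvw : inner ℝ v w = (0 : ℝ) := by
      rw [hw, inner_smul_right, inner_sub_right, inner_smul_right, hvv, ← hc]
      ring
    have hww : inner ℝ w w = (1 : ℝ) := by
      have h1 : inner ℝ (s • w) (s • w) = s ^ 2 := by
        rw [hsw, inner_sub_left, inner_sub_right, inner_sub_right, inner_smul_left,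
          inner_smul_right, inner_smul_left, inner_smul_right, hvv, hT, hvv,
          real_inner_comm v (T v), ← hc]
        simp
        linarith
      rw [inner_smul_left, inner_smul_right] at h1
      have hs2 : s ^ 2 ≠ 0 := pow_ne_zero _ hsin.ne'
      apply mul_left_cancel₀ hs2
      simp only [conj_trivial] at h1
      linarith
    have hpow (l : ℕ) : (T ^ l) v = Real.cos (l * t) • v + Real.sin (l * t) • w := by
      induction l with
      | zero => simp
      | succ l ih =>
        rw [pow_succ', Module.End.mul_apply, ih, map_add, map_smul, map_smul, hTv, hTw]
        push_cast
        rw [add_mul, one_mul, Real.cos_add, Real.sin_add, hcos, ← hs]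
        module
    have hcosm : Real.cos ((k + 1 : ℕ) * t) = 1 := by
      have h1 := congrArg (inner ℝ v) (hpow (k + 1))
      rw [hTm, Module.End.one_apply, inner_add_right, inner_smul_right, inner_smul_right, hvv,
        hvw] at h1
      linarith
    obtain ⟨j, hj⟩ := exists_rootAngle_eq hodd.pos (Real.arccos_nonneg c)
      (Real.arccos_le_pi c) hcosm
    refine ⟨j, ![v, w], ?_, ?_⟩
    · rw [orthonormal_iff_ite]
      intro a a'
      have hwv : inner ℝ w v = (0 : ℝ) := by rw [real_inner_comm, hvw]
      fin_cases a <;> fin_cases a' <;> simp [hvw, hvv, hww, hwv, -inner_self_eq_norm_sq_to_K]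
    · rw [← hj, ← ht]
      intro a
      fin_cases a
      · simpa [planeRotation, hcos, ← hs] using hTv
      · simpa [planeRotation, hcos, ← hs] using hTw

/-- A linear isometry of odd finite order has an orthonormal family of `r` rotation planes
whenever `2 * r` does not exceed the dimension. -/
theorem exists_orthonormal_rotation_family {m : ℕ} (hodd : Odd m) (T : V →ₗ[ℝ] V)
    (hT : ∀ v w, inner ℝ (T v) (T w) = inner ℝ v w) (hTm : T ^ m = 1) (r : ℕ)
    (hr : 2 * r ≤ Module.finrank ℝ V) :
    ∃ (f : Fin r → Fin (m / 2 + 1)) (v : Fin 2 × Fin r → V), Orthonormal ℝ v ∧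
      ∀ b i, T (v (b, i)) = ∑ a, planeRotation (rootAngle m (f i)) a b • v (a, i) := by
  induction r with
  | zero => exact ⟨Fin.elim0, fun p => p.2.elim0, ⟨fun p => p.2.elim0, fun p => p.2.elim0⟩,
      fun _ i => i.elim0⟩
  | succ r ih =>
    obtain ⟨f, v, hv, hTv⟩ := ih (by omega)
    set U := Submodule.span ℝ (Set.range v) with hU
    have hvU (p) : v p ∈ U := Submodule.subset_span ⟨p, rfl⟩
    have hTU : ∀ u ∈ U, T u ∈ U := by
      intro u hu
      have : U ≤ U.comap T := by
        rw [hU, Submodule.span_le]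
        rintro _ ⟨⟨b, i⟩, rfl⟩
        change T (v (b, i)) ∈ U
        rw [hTv]
        exact Submodule.sum_mem _ fun a _ => Submodule.smul_mem _ _ (hvU _)
      exact this hu
    have hTW : ∀ w ∈ Uᗮ, T w ∈ Uᗮ := by
      intro w hw u hu
      have hm1 : T ((T ^ (m - 1)) u) = u := by
        rw [← Module.End.mul_apply, ← pow_succ', Nat.sub_add_cancel hodd.pos, hTm,
          Module.End.one_apply]
      rw [← hm1, hT]
      exact hw _ (Module.End.pow_apply_mem_of_forall_mem _ hTU u hu)
    have hdim : 2 ≤ Module.finrank ℝ Uᗮ := by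
      have h1 := Submodule.finrank_add_finrank_orthogonal U
      have h2 : Module.finrank ℝ U ≤ 2 * r := by
        simpa [Set.finrank] using finrank_range_le_card (R := ℝ) v
      omega
    obtain ⟨j, e, he, hTe⟩ := exists_rotation_pair hodd hdim (T.restrict hTW)
      (fun v w => hT v w) (by
        rw [Module.End.pow_restrict]
        ext w
        simp [hTm])
    have he' := orthonormal_iff_ite.1 he
    have hv' := orthonormal_iff_ite.1 hv
    have hve (p a) : inner ℝ (v p) (e a : V) = (0 : ℝ) := (e a).2 _ (hvU p)
    refine ⟨Fin.cons j f, fun p => Fin.cons (α := fun _ => V) (e p.1 : V)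
      (fun i => v (p.1, i)) p.2, ?_, ?_⟩
    · rw [orthonormal_iff_ite]
      rintro ⟨a, i⟩ ⟨a', i'⟩
      refine Fin.cases ?_ (fun i => ?_) i <;> refine Fin.cases ?_ (fun i' => ?_) i'
      · simpa using he' a a'
      · simpa [(Fin.succ_ne_zero _).symm, real_inner_comm] using hve (a', i') a
      · simpa [Fin.succ_ne_zero] using hve (a, i) a'
      · simpa using hv' (a, i) (a', i')
    · intro b i
      refine Fin.cases ?_ (fun i => ?_) i
      · simpa using congrArg Subtype.val (hTe b)
      · simpa using hTv b i

end RotationPlanes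

theorem exists_isRotationFrame {n m : ℕ} (hodd : Odd m)
    (x : orthogonalGroup (Fin (2 * n)) ℝ) (hx : x ^ m = 1) :
    ∃ (f : Fin n → Fin (m / 2 + 1)) (v : Fin 2 × Fin n → Fin (2 * n) → ℝ),
      IsRotationFrame x.1 f v := by
  have hxx : x.1ᵀ * x.1 = 1 := (mem_orthogonalGroup_iff' _ _).1 x.2
  have hxm : x.1 ^ m = 1 := congrArg Subtype.val hx
  have hpow : (toEuclideanLin x.1) ^ m = 1 := by
    have h (l : ℕ) : (toEuclideanLin x.1) ^ l = toEuclideanLin (x.1 ^ l) := by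
      induction l with
      | zero => ext; simp
      | succ l ih =>
        ext v : 1
        rw [pow_succ', pow_succ', ih]
        simp [toLpLin_apply]
    rw [h, hxm]
    ext; simp
  obtain ⟨f, v, hv, hT⟩ := exists_orthonormal_rotation_family hodd (toEuclideanLin x.1)
    (fun v w => by
      simp only [EuclideanSpace.inner_eq_star_dotProduct, toLpLin_apply, star_trivial]
      rw [dotProduct_mulVec, vecMul_mulVec, hxx, vecMul_one])
    hpow n (by simp)
  refine ⟨f, fun p => (v p).ofLp, ⟨fun p q => ?_, fun b i => ?_⟩⟩
  · have := orthonormal_iff_ite.1 hv p q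
    rwa [EuclideanSpace.inner_eq_star_dotProduct, star_trivial, dotProduct_comm] at this
  · simpa [toLpLin_apply] using congrArg WithLp.ofLp (hT b i)

/-- For any positive integer `n` and odd positive integer `m`, the number of conjugacy
classes of the full orthogonal group `O(2n)` consisting of elements `x` with `x ^ m = 1`
equals `C(n + ⌊m/2⌋, ⌊m/2⌋)`. -/
theorem stmt_12 (n m : ℕ) (hn : 0 < n) (hm : 0 < m) (hodd : Odd m) :
    {c : ConjClasses (Matrix.orthogonalGroup (Fin (2 * n)) ℝ) |
        ∀ x ∈ c.carrier, x ^ m = 1}.ncard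
      = Nat.choose (n + m / 2) (m / 2) := by
  have hsurj (s : Sym (Fin (m / 2 + 1)) n) :
      ∃ f : Fin n → Fin (m / 2 + 1), Finset.univ.val.map f = s.1 := by
    obtain ⟨⟨l⟩, hl⟩ := s
    have hl' : l.length = n := hl
    subst hl'
    exact ⟨l.get, by rw [Fin.univ_val_map, List.ofFn_get]; rfl⟩
  choose F hF using hsurj
  have hinj : Function.Injective fun s => ConjClasses.mk (orthogonalRotationBlocks (F s)) := by
    intro s s' h
    have := (mk_orthogonalRotationBlocks_eq_iff hm).1 h
    rw [hF, hF] at this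
    exact Subtype.ext this
  have hrange : {c : ConjClasses (Matrix.orthogonalGroup (Fin (2 * n)) ℝ) |
      ∀ x ∈ c.carrier, x ^ m = 1} =
        Set.range fun s => ConjClasses.mk (orthogonalRotationBlocks (F s)) := by
    ext c
    constructor
    · intro hc
      obtain ⟨x, rfl⟩ := ConjClasses.mk_surjective c
      obtain ⟨f, v, hfv⟩ := exists_isRotationFrame hodd x (hc x ConjClasses.mem_carrier_mk)
      refine ⟨⟨Finset.univ.val.map f, by simp⟩, ?_⟩
      rw [← ConjClasses.mk_eq_mk_iff_isConj.2 hfv.isConj]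
      exact (mk_orthogonalRotationBlocks_eq_iff hm).2 (hF _)
    · rintro ⟨s, rfl⟩ x hx
      rw [ConjClasses.mem_carrier_iff_mk_eq, ConjClasses.mk_eq_mk_iff_isConj] at hx
      obtain ⟨c, hc⟩ := isConj_iff.1 hx.symm
      rw [← hc, conj_pow, orthogonalRotationBlocks_pow hm, mul_one, mul_inv_cancel]
  rw [hrange, Set.ncard_range_of_injective hinj, Nat.card_eq_fintype_card,
    Sym.card_sym_eq_choose, Fintype.card_fin,
    show m / 2 + 1 + n - 1 = n + m / 2 by omega]
  exact Nat.choose_symm_add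
end

section
/- For any positive integer n and any odd positive integer m, the number of conjugacy classes of the special orthogonal group SO(2n) consisting of elements x with x^m = 1 equals C(n + ⌊m/2⌋ - 1, ⌊m/2⌋) + 2 · C(n + ⌊m/2⌋ - 1, n). -/
open Matrix

theorem ConjClasses.ncard_pow_eq_one_of_index_two {G Y : Type*} [Group G] [Finite Y]
    (H : Subgroup G) (m : ℕ) (hH : H.index = 2) (D : Y → H) (hD : ∀ y, D y ^ m = 1)
    (hex : ∀ x : H, x ^ m = 1 → ∃ y, ∃ g : G, (x : G) = g * D y * g⁻¹)
    (hinj : ∀ y y' (g : G), g * D y * g⁻¹ = D y' → y = y')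
    (p : Y → Prop) (hp : ∀ y, p y ↔ ∃ g ∉ H, g * (D y : G) = D y * g) :
    {c : ConjClasses H | ∀ x ∈ c.carrier, x ^ m = 1}.ncard
      = Nat.card {y // p y} + 2 * Nat.card {y // ¬ p y} := by
  classical
  have hmul : ∀ a b : G, a * b ∈ H ↔ (a ∈ H ↔ b ∈ H) := fun a b =>
    Subgroup.mul_mem_iff_of_index_two hH
  have hnorm : H.Normal := Subgroup.normal_of_index_eq_two hH
  obtain ⟨r, hr⟩ : ∃ r, r ∉ H := by
    by_contra! h
    rw [(Subgroup.eq_top_iff' H).2 h] at hH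
    simp at hH
  have hconj : ∀ x y : H, IsConj x y ↔ ∃ g ∈ H, g * (x : G) * g⁻¹ = y := by
    intro x y
    rw [isConj_iff]
    constructor
    · rintro ⟨c, hc⟩
      exact ⟨c, c.2, by simpa using congrArg Subtype.val hc⟩
    · rintro ⟨g, hg, h⟩
      exact ⟨⟨g, hg⟩, Subtype.ext (by simpa using h)⟩
  let F : {y // ¬ p y} × Bool → H := fun z =>
    bif z.2 then ⟨r * D z.1 * r⁻¹, hnorm.conj_mem _ (D z.1).2 r⟩ else D z.1
  have hF : ∀ z, ∃ g : G, (F z : G) = g * D z.1 * g⁻¹ ∧ (g ∈ H ↔ z.2 = false) := by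
    rintro ⟨y, b⟩
    cases b
    · exact ⟨1, by simp [F], by simp⟩
    · exact ⟨r, by simp [F], by simp [hr]⟩
  let Φ : {y // p y} ⊕ {y // ¬ p y} × Bool → ConjClasses H :=
    Sum.elim (fun y => ConjClasses.mk (D y)) (fun z => ConjClasses.mk (F z))
  have hΦ : Function.Injective Φ := by
    rintro (y | z) (y' | z') h
    · simp only [Φ, Sum.elim_inl, ConjClasses.mk_eq_mk_iff_isConj, hconj] at h
      obtain ⟨g, -, h⟩ := h
      exact congrArg Sum.inl (Subtype.ext (hinj _ _ g h))
    · simp only [Φ, Sum.elim_inl, Sum.elim_inr, ConjClasses.mk_eq_mk_iff_isConj, hconj] at h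
      obtain ⟨g, -, h⟩ := h
      obtain ⟨a, ha, -⟩ := hF z'
      rw [ha] at h
      have := hinj y z'.1 (a⁻¹ * g) (by
        calc _ = a⁻¹ * (g * D y * g⁻¹) * a := by group
          _ = _ := by rw [h]; group)
      exact absurd (this ▸ y.2) z'.1.2
    · simp only [Φ, Sum.elim_inl, Sum.elim_inr, ConjClasses.mk_eq_mk_iff_isConj, hconj] at h
      obtain ⟨g, -, h⟩ := h
      obtain ⟨a, ha, -⟩ := hF z
      rw [ha] at h
      have := hinj z.1 y' (g * a) (by rw [← h]; group)
      exact absurd (this ▸ y'.2) z.1.2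
    · simp only [Φ, Sum.elim_inr, ConjClasses.mk_eq_mk_iff_isConj, hconj] at h
      obtain ⟨g, hg, h⟩ := h
      obtain ⟨a, ha, ha'⟩ := hF z
      obtain ⟨b, hb, hb'⟩ := hF z'
      rw [ha, hb] at h
      have h2 : (b⁻¹ * g * a) * D z.1 * (b⁻¹ * g * a)⁻¹ = D z'.1 := by
        calc _ = b⁻¹ * (g * (a * D z.1 * a⁻¹) * g⁻¹) * b := by group
          _ = _ := by rw [h]; group
      have h3 : z.1 = z'.1 := Subtype.ext (hinj _ _ _ h2)
      rw [← h3] at h2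
      have h4 : b⁻¹ * g * a ∈ H := by
        by_contra hn
        exact z.1.2 ((hp _).2 ⟨_, hn, mul_inv_eq_iff_eq_mul.1 h2⟩)
      rw [hmul, hmul, inv_mem_iff] at h4
      have h5 : z.2 = z'.2 := by
        rw [Bool.eq_iff_iff, ← not_iff_not, Bool.not_eq_true, Bool.not_eq_true, ← ha', ← hb']
        tauto
      exact congrArg Sum.inr (Prod.ext h3 h5)
  have hpow : ∀ x : H, ∀ g : G, ∀ y, (x : G) = g * D y * g⁻¹ → x ^ m = 1 := by
    intro x g y h
    apply Subtype.ext
    have := congrArg Subtype.val (hD y)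
    simp only [SubmonoidClass.coe_pow, OneMemClass.coe_one] at this ⊢
    rw [h, conj_pow, this]
    simp
  have hrange : {c : ConjClasses H | ∀ x ∈ c.carrier, x ^ m = 1} = Set.range Φ := by
    ext c
    constructor
    · intro h
      obtain ⟨x, rfl⟩ := ConjClasses.exists_rep c
      obtain ⟨y, g, hy⟩ := hex x (h x ConjClasses.mem_carrier_mk)
      by_cases hpy : p y
      · refine ⟨Sum.inl ⟨y, hpy⟩, ?_⟩
        simp only [Φ, Sum.elim_inl, ConjClasses.mk_eq_mk_iff_isConj, hconj]
        by_cases hg : g ∈ H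
        · exact ⟨g, hg, hy.symm⟩
        · obtain ⟨a, ha, h1⟩ := (hp y).1 hpy
          refine ⟨g * a, (hmul _ _).2 (by tauto), ?_⟩
          rw [hy, mul_assoc g a, h1]
          group
      · simp only [Φ, Set.mem_range]
        obtain ⟨a, ha, ha'⟩ := hF (⟨y, hpy⟩, !decide (g ∈ H))
        refine ⟨Sum.inr (⟨y, hpy⟩, !decide (g ∈ H)), ?_⟩
        simp only [Sum.elim_inr, ConjClasses.mk_eq_mk_iff_isConj, hconj]
        refine ⟨g * a⁻¹, (hmul _ _).2 ?_, ?_⟩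
        · rw [inv_mem_iff, ha']
          simp
        · rw [ha, hy]
          group
    · rintro ⟨z, rfl⟩ x hx
      rw [ConjClasses.mem_carrier_iff_mk_eq] at hx
      rcases z with y | z
      · simp only [Φ, Sum.elim_inl, ConjClasses.mk_eq_mk_iff_isConj] at hx
        obtain ⟨g, -, h⟩ := (hconj _ _).1 hx.symm
        exact hpow x g y h.symm
      · simp only [Φ, Sum.elim_inr, ConjClasses.mk_eq_mk_iff_isConj] at hx
        obtain ⟨g, -, h⟩ := (hconj _ _).1 hx.symm
        obtain ⟨a, ha, -⟩ := hF z
        refine hpow x (g * a) z.1 ?_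
        rw [← h, ha]
        group
  rw [hrange, Set.ncard_def, Set.encard, ENat.card_congr (Equiv.ofInjective Φ hΦ).symm]
  change Nat.card _ = _
  rw [Nat.card_sum, Nat.card_prod, Nat.card_eq_fintype_card (α := Bool), Fintype.card_bool, mul_comm]

/-- The orthogonal matrix acting on the `i`-th coordinate plane of `ℝ^ι ⊕ ℝ^ι` as the rotation of
angle `θ i`. -/
noncomputable def planarRotation {ι : Type*} [DecidableEq ι] (θ : ι → ℝ) :
    Matrix (ι ⊕ ι) (ι ⊕ ι) ℝ :=
  fromBlocks (diagonal fun i => Real.cos (θ i)) (diagonal fun i => -Real.sin (θ i))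
    (diagonal fun i => Real.sin (θ i)) (diagonal fun i => Real.cos (θ i))

namespace planarRotation

variable {ι : Type*} [DecidableEq ι]

theorem zero : planarRotation (0 : ι → ℝ) = 1 := by
  simp [planarRotation, ← fromBlocks_one]

theorem transpose_eq (θ : ι → ℝ) : (planarRotation θ)ᵀ = planarRotation (-θ) := by
  simp [planarRotation, fromBlocks_transpose]

theorem add_transpose (θ : ι → ℝ) : planarRotation θ + (planarRotation θ)ᵀ =
    diagonal (Sum.elim (fun i => 2 * Real.cos (θ i)) (fun i => 2 * Real.cos (θ i))) := by
  rw [transpose_eq]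
  simp [planarRotation, fromBlocks_add, diagonal_add, ← two_mul, fromBlocks_diagonal]

theorem submatrix_perm (θ : ι → ℝ) (σ : Equiv.Perm ι) :
    (planarRotation θ).submatrix (Equiv.sumCongr σ σ) (Equiv.sumCongr σ σ)
      = planarRotation (θ ∘ σ) := by
  ext (i | i) (j | j) <;> simp [planarRotation, diagonal_apply]

variable [Fintype ι]

theorem mul (θ φ : ι → ℝ) :
    planarRotation θ * planarRotation φ = planarRotation (θ + φ) := by
  simp only [planarRotation, fromBlocks_multiply, diagonal_mul_diagonal, diagonal_add,
    Pi.add_apply, Real.cos_add, Real.sin_add]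
  congr 2 <;> ext i <;> ring

theorem pow (θ : ι → ℝ) (m : ℕ) : planarRotation θ ^ m = planarRotation (fun i => m * θ i) := by
  induction m with
  | zero => rw [pow_zero, ← zero]; congr 1; ext i; simp
  | succ m ih =>
    rw [pow_succ, ih, mul]
    congr 1
    ext i
    simp
    ring

theorem transpose_mul_self (θ : ι → ℝ) : (planarRotation θ)ᵀ * planarRotation θ = 1 := by
  rw [transpose_eq, mul, neg_add_cancel, zero]

/-- Orthogonally conjugate rotations have the same cosines. -/
theorem map_cos_eq {θ φ : ι → ℝ} {g : Matrix (ι ⊕ ι) (ι ⊕ ι) ℝ} (hg : gᵀ * g = 1)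
    (h : g * planarRotation θ = planarRotation φ * g) :
    (Finset.univ.val.map fun i => Real.cos (θ i)) = Finset.univ.val.map fun i => Real.cos (φ i) := by
  have hg' : g * gᵀ = 1 := mul_eq_one_comm.1 hg
  have h1 : planarRotation φ = g * planarRotation θ * gᵀ := by
    rw [h, mul_assoc, hg', mul_one]
  have h2 : planarRotation φ + (planarRotation φ)ᵀ
      = g * (planarRotation θ + (planarRotation θ)ᵀ) * gᵀ := by
    rw [h1]
    simp only [transpose_mul, transpose_transpose, mul_add, add_mul, mul_assoc]
  have h3 := congrArg Matrix.charpoly h2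
  rw [charpoly_mul_comm, ← mul_assoc, hg, one_mul, add_transpose, add_transpose,
    charpoly_diagonal, charpoly_diagonal] at h3
  have h4 : ∀ f : ι ⊕ ι → ℝ,
      (∏ i, (Polynomial.X - Polynomial.C (f i))).roots = Finset.univ.val.map f := by
    intro f
    rw [← Polynomial.roots_multiset_prod_X_sub_C (Finset.univ.val.map f), Multiset.map_map]
    rfl
  have h5 := congrArg Polynomial.roots h3
  rw [h4, h4] at h5
  have h6 : ∀ f : ι → ℝ, ((Finset.univ : Finset (ι ⊕ ι)).val.map (Sum.elim f f))
      = Finset.univ.val.map f + Finset.univ.val.map f := by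
    intro f
    simp [← Finset.univ_disjSum_univ, Finset.val_disjSum, Multiset.disjSum]
  rw [h6, h6] at h5
  have h7 : (Finset.univ.val.map fun i => 2 * Real.cos (θ i))
      = Finset.univ.val.map fun i => 2 * Real.cos (φ i) := by
    ext a
    have := congrArg (Multiset.count a) h5
    simp only [Multiset.count_add] at this
    omega
  have h8 := congrArg (Multiset.map fun x : ℝ => x / 2) h7
  simpa [Multiset.map_map, Function.comp_def] using h8

theorem det_eq_one_of_commute {θ : ι → ℝ} (hθ : ∀ i, 0 < Real.sin (θ i))
    {g : Matrix (ι ⊕ ι) (ι ⊕ ι) ℝ} (hg : gᵀ * g = 1)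
    (h : g * planarRotation θ = planarRotation θ * g) : g.det = 1 := by
  have hg' : g * gᵀ = 1 := mul_eq_one_comm.1 hg
  set C : Matrix (ι ⊕ ι) (ι ⊕ ι) ℝ :=
    diagonal (Sum.elim (fun i => 2 * Real.sin (θ i)) (fun i => 2 * Real.sin (θ i))) with hC
  have hK : planarRotation θ - (planarRotation θ)ᵀ = J ι ℝ * C := by
    rw [transpose_eq]
    simp only [planarRotation, J, hC, ← fromBlocks_diagonal, fromBlocks_multiply]
    ext (i | i) (j | j) <;> simp [diagonal_apply] <;> split_ifs <;> ring
  have hJC : J ι ℝ * C = C * J ι ℝ := by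
    simp only [J, hC, ← fromBlocks_diagonal, fromBlocks_multiply]
    simp
  have ht : g * (planarRotation θ)ᵀ = (planarRotation θ)ᵀ * g := by
    have hR := transpose_mul_self θ
    have hR' := mul_eq_one_comm.1 hR
    calc g * (planarRotation θ)ᵀ
        = (planarRotation θ)ᵀ * (planarRotation θ * g) * (planarRotation θ)ᵀ := by
          rw [← mul_assoc, hR, one_mul]
      _ = (planarRotation θ)ᵀ * g := by rw [← h, mul_assoc, mul_assoc, hR', mul_one]
  have h1 : g * (J ι ℝ * C) = J ι ℝ * C * g := by
    rw [← hK, mul_sub, sub_mul, h, ht]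
  have hsq : J ι ℝ * C * (J ι ℝ * C) = -(C * C) := by
    rw [hJC, mul_assoc, ← mul_assoc (J ι ℝ), hJC, mul_assoc, J_squared]
    simp
  have h2 : g * (C * C) = C * C * g := by
    rw [← neg_inj, ← mul_neg, ← neg_mul (C * C) g, ← hsq, ← mul_assoc, h1,
      mul_assoc (J ι ℝ * C), h1, mul_assoc (J ι ℝ * C) (J ι ℝ * C)]
  have hpos : ∀ a : ι ⊕ ι, 0 < Sum.elim (fun i => 2 * Real.sin (θ i))
      (fun i => 2 * Real.sin (θ i)) a := by
    rintro (i | i) <;> simpa using hθ i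
  have h3 : g * C = C * g := by
    ext a b
    have h4 := congrFun (congrFun h2 a) b
    simp only [hC, diagonal_mul_diagonal, mul_diagonal, diagonal_mul] at h4 ⊢
    have ha := hpos a
    have hb := hpos b
    generalize Sum.elim (fun i => 2 * Real.sin (θ i)) (fun i => 2 * Real.sin (θ i)) a = x at *
    generalize Sum.elim (fun i => 2 * Real.sin (θ i)) (fun i => 2 * Real.sin (θ i)) b = y at *
    have h5 : (y + x) * (g a b * y - x * g a b) = 0 := by linear_combination h4
    have h6 := (mul_eq_zero.1 h5).resolve_left (by positivity)
    linarith
  have hCu : C * diagonal (fun a => (Sum.elim (fun i => 2 * Real.sin (θ i))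
      (fun i => 2 * Real.sin (θ i)) a)⁻¹) = 1 := by
    rw [hC, diagonal_mul_diagonal, ← diagonal_one]
    congr 1
    ext a
    exact mul_inv_cancel₀ (hpos a).ne'
  have h4 : g * J ι ℝ = J ι ℝ * g := by
    have h5 : g * J ι ℝ * C = J ι ℝ * g * C := by rw [mul_assoc, h1, mul_assoc, mul_assoc, h3]
    have h6 := congrArg (· * diagonal (fun a => (Sum.elim (fun i => 2 * Real.sin (θ i))
      (fun i => 2 * Real.sin (θ i)) a)⁻¹)) h5
    simpa only [mul_assoc, hCu, mul_one] using h6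
  apply SymplecticGroup.det_eq_one
  rw [SymplecticGroup.mem_iff, h4, mul_assoc, hg', mul_one]

/-- Reflections in a coordinate of a plane which is not rotated commute with the rotation. -/
theorem exists_det_eq_neg_one {θ : ι → ℝ} {i : ι} (hi : θ i = 0) :
    ∃ g : Matrix (ι ⊕ ι) (ι ⊕ ι) ℝ, gᵀ * g = 1 ∧ g.det = -1 ∧
      g * planarRotation θ = planarRotation θ * g := by
  refine ⟨diagonal (Function.update 1 (Sum.inl i) (-1)), ?_, ?_, ?_⟩
  · rw [diagonal_transpose, diagonal_mul_diagonal, ← diagonal_one]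
    congr 1
    ext a
    by_cases h : a = Sum.inl i <;> simp [h]
  · rw [det_diagonal, Finset.prod_update_of_mem (Finset.mem_univ _)]
    simp
  · ext a b
    rw [diagonal_mul, mul_diagonal]
    rcases a with a | a <;> rcases b with b | b <;>
      simp only [planarRotation, fromBlocks_apply₁₁, fromBlocks_apply₁₂, fromBlocks_apply₂₁,
        fromBlocks_apply₂₂, diagonal_apply, Function.update_apply] <;>
      by_cases h : a = b <;> simp [h] <;> rintro rfl <;> simp [hi]

/-- Permuting the angles gives an orthogonally conjugate rotation. -/
theorem exists_conj_comp_perm (θ : ι → ℝ) (σ : Equiv.Perm ι) :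
    ∃ g : Matrix (ι ⊕ ι) (ι ⊕ ι) ℝ, gᵀ * g = 1 ∧
      g * planarRotation θ = planarRotation (θ ∘ σ) * g := by
  refine ⟨(1 : Matrix (ι ⊕ ι) (ι ⊕ ι) ℝ).submatrix (Equiv.sumCongr σ σ) id, ?_, ?_⟩
  · rw [transpose_submatrix, transpose_one, submatrix_mul_equiv]
    simp
  · rw [← submatrix_perm]
    have h1 := submatrix_mul_equiv (1 : Matrix (ι ⊕ ι) (ι ⊕ ι) ℝ) (planarRotation θ)
      (Equiv.sumCongr σ σ) (Equiv.refl _) id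
    have h2 := submatrix_mul_equiv (planarRotation θ) (1 : Matrix (ι ⊕ ι) (ι ⊕ ι) ℝ)
      (Equiv.sumCongr σ σ) (Equiv.sumCongr σ σ) id
    rw [one_mul] at h1
    rw [mul_one, ← h1] at h2
    exact h2.symm

end planarRotation

/-- Functions taking each value equally often differ by a permutation of the domain. -/
theorem exists_perm_comp_eq_of_map_univ_eq {ι α : Type*} [Fintype ι] {s t : ι → α}
    (h : Finset.univ.val.map s = Finset.univ.val.map t) : ∃ σ : Equiv.Perm ι, s ∘ σ = t := by
  classical
  have hc : ∀ a, Nonempty ({i // t i = a} ≃ {i // s i = a}) := by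
    intro a
    rw [← Fintype.card_eq, Fintype.card_subtype, Fintype.card_subtype]
    have := congrArg (Multiset.count a) h
    rw [Multiset.count_map, Multiset.count_map] at this
    simp only [eq_comm (a := a)] at this
    exact this.symm
  exact ⟨Equiv.ofFiberEquiv fun a => (hc a).some, funext fun i => Equiv.ofFiberEquiv_map _ i⟩

section
variable {V : Type*} [NormedAddCommGroup V] [InnerProductSpace ℝ V]

/-- An isometry of odd order acts on the span of a vector `v` and its image, where `v` is an
eigenvector of the sum of the isometry and its inverse, as a rotation. -/
theorem exists_rotation_of_add_adjoint_eigenvector {T T' : V →ₗ[ℝ] V}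
    (hadj : ∀ x y, inner ℝ (T x) y = inner ℝ x (T' y)) (hTT' : ∀ x, T (T' x) = x)
    (hT'T : ∀ x, T' (T x) = x) {k : ℕ} (hT : ∀ x, (T ^ (2 * k + 1)) x = x)
    {v : V} {μ : ℝ} (hv : inner ℝ v v = (1 : ℝ)) (hμ : T v + T' v = μ • v) (hne : T v ≠ v) :
    ∃ f, ∃ j : Fin (k + 1), (∃ a b : ℝ, f = a • v + b • T v) ∧
      inner ℝ f f = (1 : ℝ) ∧ inner ℝ v f = (0 : ℝ) ∧
      T v = Real.cos (2 * Real.pi * j / (2 * k + 1)) • v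
        + Real.sin (2 * Real.pi * j / (2 * k + 1)) • f ∧
      T f = -Real.sin (2 * Real.pi * j / (2 * k + 1)) • v
        + Real.cos (2 * Real.pi * j / (2 * k + 1)) • f := by
  obtain ⟨c, rfl⟩ : ∃ c, μ = 2 * c := ⟨μ / 2, by ring⟩
  have hc : inner ℝ (T v) v = c := by
    have h1 : inner ℝ (T v + T' v) v = 2 * c := by rw [hμ, inner_smul_left, hv]; simp
    rw [inner_add_left, real_inner_comm, real_inner_comm v, ← hadj, real_inner_comm] at h1
    linarith
  have hc' : inner ℝ v (T v) = c := by rw [real_inner_comm, hc]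
  have hTT : inner ℝ (T v) (T v) = (1 : ℝ) := by rw [hadj, hT'T, hv]
  have hw : inner ℝ (T v - c • v) (T v - c • v) = 1 - c ^ 2 := by
    simp only [inner_sub_left, inner_sub_right, inner_smul_left, inner_smul_right, hc, hc', hTT, hv]
    simp
    ring
  have hpos : 0 < 1 - c ^ 2 := by
    rw [← hw, real_inner_self_pos, Ne, sub_eq_zero]
    intro h
    have h1 : ∀ l : ℕ, (T ^ l) v = c ^ l • v := by
      intro l
      induction l with
      | zero => simp
      | succ l ih => rw [pow_succ', Module.End.mul_apply, ih, map_smul, h, smul_smul, pow_succ]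
    have h2 : c ^ (2 * k + 1) = 1 := by
      have h3 : inner ℝ ((T ^ (2 * k + 1)) v) v = (1 : ℝ) := by rw [hT, hv]
      rw [h1, inner_smul_left, hv] at h3
      simpa using h3
    have h3 : c = 1 := by
      have := (Odd.strictMono_pow (R := ℝ) (n := 2 * k + 1) ⟨k, rfl⟩).injective
      apply this
      simpa using h2
    exact hne (by rw [h, h3, one_smul])
  set θ := Real.arccos c with hθ
  have hcos : Real.cos θ = c := Real.cos_arccos (by nlinarith) (by nlinarith)
  have hθ0 : 0 < θ := Real.arccos_pos.2 (by nlinarith)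
  have hθπ : θ < Real.pi := by
    refine lt_of_le_of_ne (Real.arccos_le_pi c) fun h => ?_
    rw [h, Real.cos_pi] at hcos
    rw [← hcos] at hpos
    norm_num at hpos
  have hsin : 0 < Real.sin θ := Real.sin_pos_of_pos_of_lt_pi hθ0 hθπ
  have hsc := Real.sin_sq_add_cos_sq θ
  set s := Real.sin θ
  rw [hcos] at hsc
  obtain ⟨f, hf⟩ : ∃ f, f = s⁻¹ • (T v - c • v) := ⟨_, rfl⟩
  have hTv : T v = c • v + s • f := by
    rw [hf, smul_smul, mul_inv_cancel₀ hsin.ne', one_smul, add_sub_cancel]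
  have hTTv : T (T v) = (2 * c) • T v - v := by
    have h1 := congrArg T hμ
    rw [map_add, hTT', map_smul] at h1
    rw [← h1, add_sub_cancel_right]
  have hTf : T f = -s • v + c • f := by
    have h1 : s • T f = s • (-s • v + c • f) := by
      have h2 : s • T f = T (T v) - c • T v := by
        have h3 := congrArg T hTv
        rw [map_add, map_smul, map_smul] at h3
        rw [h3, add_sub_cancel_left]
      rw [h2, hTTv, hTv]
      have : v = (s ^ 2 + c ^ 2) • v := by rw [hsc, one_smul]
      nth_rw 2 [this]
      module
    exact smul_right_injective V hsin.ne' h1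
  have hff : inner ℝ f f = (1 : ℝ) := by
    rw [hf, inner_smul_left, inner_smul_right, hw]
    simp
    field_simp
    linarith
  have hvf : inner ℝ v f = (0 : ℝ) := by
    rw [hf, inner_smul_right, inner_sub_right, inner_smul_right, hc', hv]
    simp
  have hpow : ∀ l : ℕ, (T ^ l) v = Real.cos (l * θ) • v + Real.sin (l * θ) • f := by
    intro l
    induction l with
    | zero => simp
    | succ l ih =>
      rw [pow_succ', Module.End.mul_apply, ih, map_add, map_smul, map_smul, hTf, hTv]
      push_cast
      rw [add_mul, one_mul, Real.cos_add, Real.sin_add, hcos]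
      module
  have hcm : Real.cos ((2 * k + 1 : ℕ) * θ) = 1 := by
    have h1 : inner ℝ v ((T ^ (2 * k + 1)) v) = (1 : ℝ) := by rw [hT, hv]
    rw [hpow, inner_add_right, inner_smul_right, inner_smul_right, hv, hvf] at h1
    simpa using h1
  obtain ⟨z, hz⟩ := (Real.cos_eq_one_iff _).1 hcm
  push_cast at hz
  have hk : (0 : ℝ) < 2 * k + 1 := by positivity
  have hz0 : 0 < z := by
    have : (0 : ℝ) < z * (2 * Real.pi) := by rw [hz]; positivity
    have := pos_of_mul_pos_left this (by positivity)
    exact_mod_cast this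
  have hzk : z < k + 1 := by
    have h1 : (z : ℝ) * (2 * Real.pi) < (2 * k + 1) * Real.pi := by rw [hz]; gcongr
    have h2 : (2 * z : ℝ) < 2 * k + 1 := by
      have := Real.pi_pos
      nlinarith
    have h3 : 2 * z < 2 * k + 1 := by exact_mod_cast h2
    omega
  have hj : 2 * Real.pi * ((z.toNat : ℕ) : ℝ) / (2 * k + 1) = θ := by
    have : ((z.toNat : ℕ) : ℝ) = z := by exact_mod_cast Int.toNat_of_nonneg hz0.le
    rw [this, div_eq_iff hk.ne']
    linarith
  refine ⟨f, ⟨z.toNat, by omega⟩, ⟨-s⁻¹ * c, s⁻¹, ?_⟩, hff, hvf, ?_, ?_⟩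
  · rw [hf]; module
  · simp only [hj, hcos]; exact hTv
  · simp only [hj, hcos]; exact hTf

/-- An isometry of odd order rotates some plane inside any invariant subspace of dimension at
least two. -/
theorem exists_rotation_in_invariant_subspace [FiniteDimensional ℝ V] {T T' : V →ₗ[ℝ] V}
    (hadj : ∀ x y, inner ℝ (T x) y = inner ℝ x (T' y)) (hTT' : ∀ x, T (T' x) = x)
    (hT'T : ∀ x, T' (T x) = x) {k : ℕ} (hT : ∀ x, (T ^ (2 * k + 1)) x = x)
    (W : Submodule ℝ V) (hW : ∀ x ∈ W, T x ∈ W) (hW' : ∀ x ∈ W, T' x ∈ W)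
    (hdim : 2 ≤ Module.finrank ℝ W) :
    ∃ v ∈ W, ∃ f ∈ W, ∃ j : Fin (k + 1), inner ℝ v v = (1 : ℝ) ∧
      inner ℝ f f = (1 : ℝ) ∧ inner ℝ v f = (0 : ℝ) ∧
      T v = Real.cos (2 * Real.pi * j / (2 * k + 1)) • v
        + Real.sin (2 * Real.pi * j / (2 * k + 1)) • f ∧
      T f = -Real.sin (2 * Real.pi * j / (2 * k + 1)) • v
        + Real.cos (2 * Real.pi * j / (2 * k + 1)) • f := by
  let S : W →ₗ[ℝ] W := (T + T').restrict (fun x hx => W.add_mem (hW x hx) (hW' x hx))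
  have hS : S.IsSymmetric := by
    intro x y
    simp only [S, Submodule.coe_inner, LinearMap.coe_restrict_apply, LinearMap.add_apply,
      inner_add_left, inner_add_right]
    have h1 : inner ℝ (x : V) (T y) = inner ℝ (T' (x : V)) (y : V) := by
      rw [real_inner_comm, hadj, real_inner_comm]
    rw [hadj, h1, add_comm]
  let b := hS.eigenvectorBasis rfl
  have hb : ∀ i, inner ℝ (b i : V) (b i : V) = (1 : ℝ) := fun i => by
    rw [← Submodule.coe_inner, real_inner_self_eq_norm_sq, b.norm_eq_one, one_pow]
  by_cases h : ∃ i, T (b i) ≠ b i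
  · obtain ⟨i, hi⟩ := h
    have h1 : T (b i : V) + T' (b i : V) = hS.eigenvalues rfl i • (b i : V) := by
      exact congrArg Subtype.val (hS.apply_eigenvectorBasis rfl i)
    obtain ⟨f, j, ⟨p, q, hf⟩, h2⟩ :=
      exists_rotation_of_add_adjoint_eigenvector hadj hTT' hT'T hT (hb i) h1 hi
    refine ⟨b i, (b i).2, f, ?_, j, hb i, h2⟩
    rw [hf]
    exact W.add_mem (W.smul_mem _ (b i).2) (W.smul_mem _ (hW _ (b i).2))
  · push Not at h
    refine ⟨b ⟨0, by omega⟩, Subtype.prop _, b ⟨1, by omega⟩, Subtype.prop _, 0, hb _, hb _, ?_, ?_, ?_⟩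
    · rw [← Submodule.coe_inner]
      exact b.orthonormal.2 (by simp)
    · simp [h]
    · simp [h]

/-- An isometry of odd order acts as planar rotations on `p` pairwise orthogonal planes, as long as
the space is large enough to contain them. -/
theorem exists_rotation_family [FiniteDimensional ℝ V] {T T' : V →ₗ[ℝ] V}
    (hadj : ∀ x y, inner ℝ (T x) y = inner ℝ x (T' y)) (hTT' : ∀ x, T (T' x) = x)
    (hT'T : ∀ x, T' (T x) = x) {k : ℕ} (hT : ∀ x, (T ^ (2 * k + 1)) x = x)
    (p : ℕ) (hp : 2 * p ≤ Module.finrank ℝ V) :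
    ∃ (e f : Fin p → V) (j : Fin p → Fin (k + 1)),
      (∀ i i', inner ℝ (e i) (e i') = if i = i' then (1 : ℝ) else 0) ∧
      (∀ i i', inner ℝ (f i) (f i') = if i = i' then (1 : ℝ) else 0) ∧
      (∀ i i', inner ℝ (e i) (f i') = (0 : ℝ)) ∧
      (∀ i, T (e i) = Real.cos (2 * Real.pi * j i / (2 * k + 1)) • e i
        + Real.sin (2 * Real.pi * j i / (2 * k + 1)) • f i) ∧
      (∀ i, T (f i) = -Real.sin (2 * Real.pi * j i / (2 * k + 1)) • e i
        + Real.cos (2 * Real.pi * j i / (2 * k + 1)) • f i) := by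
  induction p with
  | zero => exact ⟨nofun, nofun, nofun, nofun, nofun, nofun, nofun, nofun⟩
  | succ p ih =>
    obtain ⟨e, f, j, hee, hff, hef, hTe, hTf⟩ := ih (by omega)
    let U := Submodule.span ℝ (Set.range (Sum.elim e f))
    have hU : Module.finrank ℝ U ≤ 2 * p := by
      have := finrank_range_le_card (R := ℝ) (Sum.elim e f)
      simp only [Fintype.card_sum, Fintype.card_fin] at this
      exact this.trans (by omega)
    have hmem : ∀ y, y ∈ Uᗮ ↔ ∀ i, inner ℝ (e i) y = (0 : ℝ) ∧ inner ℝ (f i) y = (0 : ℝ) := by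
      intro y
      rw [Submodule.mem_orthogonal]
      constructor
      · intro h i
        exact ⟨h _ (Submodule.subset_span ⟨Sum.inl i, rfl⟩),
          h _ (Submodule.subset_span ⟨Sum.inr i, rfl⟩)⟩
      · intro h u hu
        induction hu using Submodule.span_induction with
        | mem x hx =>
          obtain ⟨i | i, rfl⟩ := hx
          · exact (h i).1
          · exact (h i).2
        | zero => simp
        | add x y _ _ hx hy => rw [inner_add_left, hx, hy, add_zero]
        | smul a x _ hx => rw [inner_smul_left, hx, mul_zero]
    have hadj' : ∀ x y, inner ℝ (T' x) y = inner ℝ x (T y) := fun x y => by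
      rw [real_inner_comm, ← hadj, real_inner_comm]
    have hT'e : ∀ i, T' (e i) = Real.cos (2 * Real.pi * j i / (2 * k + 1)) • e i
        - Real.sin (2 * Real.pi * j i / (2 * k + 1)) • f i := by
      intro i
      rw [← hT'T (_ - _), map_sub, map_smul, map_smul, hTe, hTf]
      congr 1
      have := Real.sin_sq_add_cos_sq (2 * Real.pi * j i / (2 * k + 1))
      nth_rw 1 [← one_smul ℝ (e i), ← this]
      module
    have hT'f : ∀ i, T' (f i) = Real.sin (2 * Real.pi * j i / (2 * k + 1)) • e i
        + Real.cos (2 * Real.pi * j i / (2 * k + 1)) • f i := by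
      intro i
      rw [← hT'T (_ + _), map_add, map_smul, map_smul, hTe, hTf]
      congr 1
      have := Real.sin_sq_add_cos_sq (2 * Real.pi * j i / (2 * k + 1))
      nth_rw 1 [← one_smul ℝ (f i), ← this]
      module
    obtain ⟨v, hv, w, hw, l, hvv, hww, hvw, hTv, hTw⟩ :=
      exists_rotation_in_invariant_subspace hadj hTT' hT'T hT Uᗮ
        (fun x hx => by
          rw [hmem] at hx ⊢
          intro i
          simp [← hadj', hT'e, hT'f, inner_add_left, inner_sub_left, inner_smul_left, hx i])
        (fun x hx => by
          rw [hmem] at hx ⊢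
          intro i
          simp [← hadj, hTe, hTf, inner_add_left, inner_smul_left, hx i])
        (by have := U.finrank_add_finrank_orthogonal; omega)
    rw [hmem] at hv hw
    have hv' : ∀ i, inner ℝ v (e i) = (0 : ℝ) ∧ inner ℝ v (f i) = (0 : ℝ) := fun i => by
      rw [real_inner_comm, real_inner_comm (f i)]; exact hv i
    have hw' : ∀ i, inner ℝ w (f i) = (0 : ℝ) := fun i => by
      rw [real_inner_comm]; exact (hw i).2
    refine ⟨Fin.cons v e, Fin.cons w f, Fin.cons l j, ?_, ?_, ?_, ?_, ?_⟩
    · refine Fin.cases (Fin.cases ?_ ?_) fun i => Fin.cases ?_ ?_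
      · simpa using hvv
      · intro i; simpa [(Fin.succ_ne_zero i).symm] using (hv' i).1
      · simpa using (hv i).1
      · intro i'; simpa using hee i i'
    · refine Fin.cases (Fin.cases ?_ ?_) fun i => Fin.cases ?_ ?_
      · simpa using hww
      · intro i; simpa [(Fin.succ_ne_zero i).symm] using hw' i
      · simpa using (hw i).2
      · intro i'; simpa using hff i i'
    · refine Fin.cases (Fin.cases ?_ ?_) fun i => Fin.cases ?_ ?_
      · simpa using hvw
      · intro i; simpa using (hv' i).2
      · simpa using (hw i).1
      · intro i'; simpa using hef i i'
    · refine Fin.cases ?_ fun i => ?_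
      · simpa using hTv
      · simpa using hTe i
    · refine Fin.cases ?_ fun i => ?_
      · simpa using hTw
      · simpa using hTf i
end

/-- Every orthogonal matrix of odd order on an even-dimensional space is orthogonally conjugate to a
standard planar rotation. -/
theorem exists_conj_planarRotation {n k : ℕ} {x : Matrix (Fin n ⊕ Fin n) (Fin n ⊕ Fin n) ℝ}
    (hx : xᵀ * x = 1) (hpow : x ^ (2 * k + 1) = 1) :
    ∃ (j : Fin n → Fin (k + 1)) (g : Matrix (Fin n ⊕ Fin n) (Fin n ⊕ Fin n) ℝ), gᵀ * g = 1 ∧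
      x * g = g * planarRotation fun i => 2 * Real.pi * j i / (2 * k + 1) := by
  have hx' : x * xᵀ = 1 := mul_eq_one_comm.1 hx
  have hT : ∀ l : ℕ, (toEuclideanLin x) ^ l = toEuclideanLin (x ^ l) := by
    intro l
    induction l with
    | zero => ext v a; simp
    | succ l ih => rw [pow_succ, ih]; ext v a; simp [pow_succ]
  obtain ⟨e, f, j, hee, hff, hef, hTe, hTf⟩ :=
    exists_rotation_family (V := EuclideanSpace ℝ (Fin n ⊕ Fin n))
      (T := toEuclideanLin x) (T' := toEuclideanLin xᵀ)
      (fun u v => by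
        rw [← conjTranspose_eq_transpose_of_trivial, toEuclideanLin_conjTranspose_eq_adjoint,
          LinearMap.adjoint_inner_right])
      (fun u => by ext a; simp [hx'])
      (fun u => by ext a; simp [hx])
      (k := k) (fun u => by rw [hT, hpow]; ext a; simp) n (by simp; omega)
  refine ⟨j, of fun a => Sum.elim (fun i => e i a) (fun i => f i a), ?_, ?_⟩
  · have hin : ∀ u v : EuclideanSpace ℝ (Fin n ⊕ Fin n), ∑ a, u a * v a = inner ℝ u v := by
      intro u v
      simp [PiLp.inner_apply, mul_comm]
    ext (i | i) (i' | i') <;>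
      simp only [mul_apply, transpose_apply, of_apply, Sum.elim_inl, Sum.elim_inr, hin, one_apply,
        Sum.inl.injEq, Sum.inr.injEq, reduceCtorEq, if_false]
    · exact hee i i'
    · exact hef i i'
    · rw [real_inner_comm]; exact hef i' i
    · exact hff i i'
  · have hmul : ∀ (u : EuclideanSpace ℝ (Fin n ⊕ Fin n)) a,
        ∑ b, x a b * u b = (toEuclideanLin x u) a := by
      intro u a
      simp [mulVec, dotProduct]
    ext a (i | i) <;>
      simp only [mul_apply, of_apply, Sum.elim_inl, Sum.elim_inr, hmul, hTe, hTf,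
        Fintype.sum_sum_type, planarRotation, fromBlocks_apply₁₁, fromBlocks_apply₁₂,
        fromBlocks_apply₂₁, fromBlocks_apply₂₂, diagonal_apply] <;>
      simp [mul_comm]

theorem Sym.card_mem_zero (k n : ℕ) :
    Nat.card {y : Sym (Fin (k + 1)) (n + 1) // 0 ∈ y} = Nat.multichoose (k + 1) n := by
  rw [Nat.card_congr (Sym.e1 (n := k) (k := n)), Nat.card_eq_fintype_card,
    Sym.card_sym_fin_eq_multichoose]

theorem Sym.card_not_mem_zero (k n : ℕ) :
    Nat.card {y : Sym (Fin (k + 1)) (n + 1) // 0 ∉ y} = Nat.multichoose k (n + 1) := by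
  classical
  have h1 := Fintype.card_subtype_compl (fun y : Sym (Fin (k + 1)) (n + 1) => 0 ∈ y)
  have h2 := Sym.card_mem_zero k n
  rw [Nat.card_eq_fintype_card] at h2 ⊢
  rw [h1, h2, Sym.card_sym_fin_eq_multichoose, Nat.multichoose_succ_succ, Nat.add_sub_cancel]

/-- The angles `2πj/(2k+1)` with `j ≤ k` lie in `[0, π]`, hence have distinct cosines. -/
theorem cos_two_pi_mul_div_injective (k : ℕ) :
    Function.Injective fun j : Fin (k + 1) => Real.cos (2 * Real.pi * j / (2 * k + 1)) := by
  have hk : (0 : ℝ) < 2 * k + 1 := by positivity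
  have hmem : ∀ j : Fin (k + 1), 2 * Real.pi * j / (2 * k + 1) ∈ Set.Icc 0 Real.pi := by
    intro j
    have hj : (j : ℝ) ≤ k := by exact_mod_cast Nat.lt_succ_iff.1 j.2
    have := Real.pi_pos
    refine ⟨by positivity, ?_⟩
    rw [div_le_iff₀ hk]
    nlinarith
  intro i j h
  have := Real.injOn_cos (hmem i) (hmem j) h
  rw [div_left_inj' hk.ne', mul_right_inj' (by positivity)] at this
  exact Fin.ext (by exact_mod_cast this)

theorem sin_two_pi_mul_div_pos {k : ℕ} {j : Fin (k + 1)} (hj : j ≠ 0) :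
    0 < Real.sin (2 * Real.pi * j / (2 * k + 1)) := by
  have hk : (0 : ℝ) < 2 * k + 1 := by positivity
  have hj0 : (0 : ℝ) < j := by exact_mod_cast Nat.pos_of_ne_zero fun h => hj (Fin.ext h)
  have hjk : (j : ℝ) ≤ k := by exact_mod_cast Nat.lt_succ_iff.1 j.2
  have := Real.pi_pos
  refine Real.sin_pos_of_pos_of_lt_pi (by positivity) ?_
  rw [div_lt_iff₀ hk]
  nlinarith

theorem det_eq_one_or_neg_one_of_orthogonal {ι : Type*} [DecidableEq ι] [Fintype ι]
    {g : Matrix ι ι ℝ} (hg : gᵀ * g = 1) : g.det = 1 ∨ g.det = -1 := by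
  have := congrArg det hg
  rw [det_mul, det_transpose, det_one] at this
  exact mul_self_eq_one_iff.1 this

/-- The matrix algebras over `Fin n ⊕ Fin n` and `Fin (2 * n)` are isomorphic. -/
noncomputable def splitAlgEquiv (n : ℕ) :
    Matrix (Fin n ⊕ Fin n) (Fin n ⊕ Fin n) ℝ ≃ₐ[ℝ] Matrix (Fin (2 * n)) (Fin (2 * n)) ℝ :=
  reindexAlgEquiv ℝ ℝ (finSumFinEquiv.trans (finCongr (two_mul n).symm))

theorem transpose_splitAlgEquiv {n : ℕ} (M : Matrix (Fin n ⊕ Fin n) (Fin n ⊕ Fin n) ℝ) :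
    (splitAlgEquiv n M)ᵀ = splitAlgEquiv n Mᵀ := rfl

theorem det_splitAlgEquiv {n : ℕ} (M : Matrix (Fin n ⊕ Fin n) (Fin n ⊕ Fin n) ℝ) :
    (splitAlgEquiv n M).det = M.det :=
  det_reindexAlgEquiv _ _ _ _

/-- The orthogonal transformation of `ℝ^(2n)` given by an orthogonal matrix in split coordinates. -/
noncomputable def splitOrthogonal {n : ℕ} (M : Matrix (Fin n ⊕ Fin n) (Fin n ⊕ Fin n) ℝ)
    (hM : Mᵀ * M = 1) : orthogonalGroup (Fin (2 * n)) ℝ :=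
  ⟨splitAlgEquiv n M, by
    rw [mem_orthogonalGroup_iff', transpose_splitAlgEquiv, ← map_mul, hM, map_one]⟩

theorem exists_splitOrthogonal_eq {n : ℕ} (g : orthogonalGroup (Fin (2 * n)) ℝ) :
    ∃ M hM, g = splitOrthogonal (n := n) M hM := by
  obtain ⟨M, hM⟩ := (splitAlgEquiv n).surjective (g : Matrix _ _ ℝ)
  refine ⟨M, ?_, Subtype.ext hM.symm⟩
  have := (mem_orthogonalGroup_iff' _ _).1 g.2
  rw [← hM, transpose_splitAlgEquiv, ← map_mul] at this
  exact (splitAlgEquiv n).injective (by rw [this, map_one])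

theorem splitOrthogonal_mem_SO {n : ℕ} {M : Matrix (Fin n ⊕ Fin n) (Fin n ⊕ Fin n) ℝ}
    {hM : Mᵀ * M = 1} : splitOrthogonal M hM ∈ SO (2 * n) ↔ M.det = 1 := by
  rw [← det_splitAlgEquiv]
  rfl

theorem splitOrthogonal_mul_eq_mul {n : ℕ} {A B C D : Matrix (Fin n ⊕ Fin n) (Fin n ⊕ Fin n) ℝ}
    {hA : Aᵀ * A = 1} {hB : Bᵀ * B = 1} {hC : Cᵀ * C = 1} {hD : Dᵀ * D = 1} :
    splitOrthogonal A hA * splitOrthogonal B hB = splitOrthogonal C hC * splitOrthogonal D hD ↔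
      A * B = C * D := by
  rw [← (splitAlgEquiv n).injective.eq_iff, map_mul, map_mul, Subtype.ext_iff]
  rfl

theorem SO_index_two {n : ℕ} (hn : 0 < n) : (SO (2 * n)).index = 2 := by
  rw [Subgroup.index_eq_two_iff_exists_notMem_and']
  obtain ⟨M, hM, hdet, -⟩ := planarRotation.exists_det_eq_neg_one (θ := (0 : Fin n → ℝ))
    (i := ⟨0, hn⟩) rfl
  refine ⟨splitOrthogonal M hM, ?_, fun g => ?_⟩
  · rw [splitOrthogonal_mem_SO, hdet]
    norm_num
  · obtain ⟨N, hN, rfl⟩ := exists_splitOrthogonal_eq g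
    rcases det_eq_one_or_neg_one_of_orthogonal hN with h | h
    · exact Or.inr (splitOrthogonal_mem_SO.2 h)
    · left
      change ((splitAlgEquiv n M) * (splitAlgEquiv n N)).det = 1
      rw [det_mul, det_splitAlgEquiv, det_splitAlgEquiv, h, hdet]
      norm_num

theorem Sym.exists_map_univ_eq {α : Type*} {n : ℕ} (y : Sym α n) :
    ∃ s : Fin n → α, Finset.univ.val.map s = (y : Multiset α) := by
  obtain ⟨y, hy⟩ := y
  induction y using Quotient.inductionOn with
  | h l =>
    obtain rfl : l.length = n := hy
    refine ⟨l.get, ?_⟩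
    rw [Fin.univ_val_map, List.ofFn_get]
    rfl

theorem planarRotation_pow_eq_one {n k : ℕ} (j : Fin n → Fin (k + 1)) :
    planarRotation (fun i => 2 * Real.pi * j i / (2 * k + 1)) ^ (2 * k + 1) = 1 := by
  rw [planarRotation.pow, ← planarRotation.zero]
  have h : ∀ i, ((2 * k + 1 : ℕ) : ℝ) * (2 * Real.pi * j i / (2 * k + 1)) =
      (j i : ℕ) * (2 * Real.pi) := by
    intro i
    have hk : (2 * k + 1 : ℝ) ≠ 0 := by positivity
    push_cast
    field_simp
  have hsin : ∀ l : ℕ, Real.sin (l * (2 * Real.pi)) = 0 := fun l => by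
    have := Real.sin_nat_mul_pi (l * 2)
    push_cast at this
    rw [← this]
    ring_nf
  simp only [h, planarRotation, Real.cos_nat_mul_two_pi, hsin]
  simp

theorem SO_ncard_conjClasses (n k : ℕ) :
    {c : ConjClasses (SO (2 * (n + 1))) | ∀ x ∈ c.carrier, x ^ (2 * k + 1) = 1}.ncard
      = Nat.multichoose (k + 1) n + 2 * Nat.multichoose k (n + 1) := by
  rw [← Sym.card_mem_zero, ← Sym.card_not_mem_zero]
  choose s hs using fun y : Sym (Fin (k + 1)) (n + 1) => y.exists_map_univ_eq
  let R : (Fin (n + 1) → Fin (k + 1)) → Matrix (Fin (n + 1) ⊕ Fin (n + 1)) _ ℝ :=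
    fun j => planarRotation fun i => 2 * Real.pi * j i / (2 * k + 1)
  have hR : ∀ j, (R j)ᵀ * R j = 1 := fun j => planarRotation.transpose_mul_self _
  have hRm : ∀ j, R j ^ (2 * k + 1) = 1 := planarRotation_pow_eq_one
  have hdet : ∀ j, (R j).det = 1 := by
    intro j
    have h := congrArg det (hRm j)
    rw [det_pow, det_one] at h
    exact (Odd.strictMono_pow (R := ℝ) (n := 2 * k + 1) ⟨k, rfl⟩).injective (by simpa using h)
  refine ConjClasses.ncard_pow_eq_one_of_index_two (SO (2 * (n + 1))) _
    (SO_index_two n.succ_pos)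
    (fun y => ⟨splitOrthogonal (R (s y)) (hR _), splitOrthogonal_mem_SO.2 (hdet _)⟩)
    ?_ ?_ ?_ _ ?_
  · intro y
    apply Subtype.ext
    apply Subtype.ext
    change splitAlgEquiv _ _ ^ _ = 1
    rw [← map_pow, hRm, map_one]
  · rintro ⟨x, hx⟩ hxm
    obtain ⟨M, hM, rfl⟩ := exists_splitOrthogonal_eq x
    have hMm : M ^ (2 * k + 1) = 1 := by
      apply (splitAlgEquiv _).injective
      rw [map_pow, map_one]
      exact congrArg Subtype.val (congrArg Subtype.val hxm)
    obtain ⟨j, g, hg, h⟩ := exists_conj_planarRotation hM hMm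
    let y : Sym (Fin (k + 1)) (n + 1) := ⟨Finset.univ.val.map j, by simp⟩
    obtain ⟨σ, hσ⟩ := exists_perm_comp_eq_of_map_univ_eq (hs y)
    obtain ⟨a, ha, h'⟩ := planarRotation.exists_conj_comp_perm
      (fun i => 2 * Real.pi * s y i / (2 * k + 1)) σ
    have hga : (g * a)ᵀ * (g * a) = 1 := by
      rw [transpose_mul, mul_assoc, ← mul_assoc gᵀ, hg, one_mul, ha]
    refine ⟨y, splitOrthogonal (g * a) hga, ?_⟩
    rw [eq_mul_inv_iff_mul_eq]
    refine (splitOrthogonal_mul_eq_mul (hA := hM) (hB := hga) (hC := hga) (hD := hR _)).2 ?_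
    have h'' : a * R (s y) = R j * a := by
      rw [← hσ]
      exact h'
    rw [← mul_assoc, h, mul_assoc, mul_assoc, h'']
  · intro y y' g h
    obtain ⟨g, hg, rfl⟩ := exists_splitOrthogonal_eq g
    rw [mul_inv_eq_iff_eq_mul] at h
    have h1 := planarRotation.map_cos_eq hg
      ((splitOrthogonal_mul_eq_mul (hB := hR (s y)) (hC := hR (s y'))).1 h)
    apply Sym.coe_injective
    rw [← hs, ← hs]
    apply Multiset.map_injective (cos_two_pi_mul_div_injective k)
    simpa only [Multiset.map_map, Function.comp_def] using h1
  · intro y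
    have hmem : (0 : Fin (k + 1)) ∈ y ↔ ∃ i, s y i = 0 := by
      rw [← Sym.mem_coe, ← hs]
      simp only [Multiset.mem_map, Finset.mem_val, Finset.mem_univ, true_and]
    rw [hmem]
    constructor
    · rintro ⟨i, hi⟩
      obtain ⟨g, hg, hgd, h⟩ := planarRotation.exists_det_eq_neg_one
        (θ := fun i => 2 * Real.pi * s y i / (2 * k + 1)) (i := i) (by simp [hi])
      refine ⟨splitOrthogonal g hg, ?_,
        (splitOrthogonal_mul_eq_mul (hB := hR (s y)) (hC := hR (s y))).2 h⟩
      rw [splitOrthogonal_mem_SO, hgd]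
      norm_num
    · rintro ⟨g, hg, h⟩
      obtain ⟨g, hg', rfl⟩ := exists_splitOrthogonal_eq g
      by_contra! hne
      exact hg (splitOrthogonal_mem_SO.2 (planarRotation.det_eq_one_of_commute
        (fun i => sin_two_pi_mul_div_pos (hne i)) hg'
        ((splitOrthogonal_mul_eq_mul (hB := hR (s y)) (hC := hR (s y))).1 h)))

/-- For any positive integer `n` and odd positive integer `m`, the number of conjugacy
classes of `SO(2n)` consisting of elements `x` with `x ^ m = 1` equals
`C(n + ⌊m/2⌋ - 1, ⌊m/2⌋) + 2 · C(n + ⌊m/2⌋ - 1, n)`. -/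
theorem stmt_13 (n m : ℕ) (hn : 0 < n) (hm : 0 < m) (hodd : Odd m) :
    {c : ConjClasses (SO (2 * n)) | ∀ x ∈ c.carrier, x ^ m = 1}.ncard
      = Nat.choose (n + m / 2 - 1) (m / 2) + 2 * Nat.choose (n + m / 2 - 1) n := by
  obtain ⟨k, rfl⟩ := hodd
  obtain ⟨n, rfl⟩ := Nat.exists_eq_succ_of_ne_zero hn.ne'
  have hk : (2 * k + 1) / 2 = k := by omega
  rw [SO_ncard_conjClasses, hk, Nat.multichoose_eq, Nat.multichoose_eq]
  have h1 : k + 1 + n - 1 = n + k := by omega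
  have h2 : k + (n + 1) - 1 = n + k := by omega
  have h3 : n + 1 + k - 1 = n + k := by omega
  rw [Nat.succ_eq_add_one, h1, h2, h3, Nat.choose_symm_add]
end
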